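/- arXiv:2010.15580 — 2 statements merged into one kernel-verified Lean document; each statement's English description precedes it below -/
import Mathlib

section
/- Every positive integer n can be written as n = x² + m where x is a nonnegative integer and m is a positive squarefree integer. -/
/-- The set of `t < T` for which `a + b * t` is divisible by no element of `Q`. -/
def siftedSet (Q : Finset ℕ) (a b T : ℕ) : Finset ℕ :=
  (Finset.range T).filter fun t => ∀ q ∈ Q, ¬ q ∣ a + b * t

/-- The expected density of integers divisible by no element of `Q`. -/
noncomputable def siftedDensity (Q : Finset ℕ) : ℝ := ∏ q ∈ Q, (1 - 1 / (q : ℝ))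

lemma siftedDensity_pos {Q : Finset ℕ} (hQ : ∀ q ∈ Q, q.Prime) : 0 < siftedDensity Q := by
  refine Finset.prod_pos fun q hq => ?_
  have : (1 : ℝ) < q := by exact_mod_cast (hQ q hq).one_lt
  rw [sub_pos, div_lt_one (by linarith)]
  exact this

lemma siftedDensity_le_one {Q : Finset ℕ} (hQ : ∀ q ∈ Q, q.Prime) : siftedDensity Q ≤ 1 := by
  refine Finset.prod_le_one (fun q hq => ?_) fun q hq => ?_
  · have : (1 : ℝ) < q := by exact_mod_cast (hQ q hq).one_lt
    rw [sub_nonneg, div_le_one (by linarith)]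
    exact this.le
  · have : (0 : ℝ) ≤ 1 / q := by positivity
    linarith

/-- A residue class of indices modulo `d` is again an arithmetic progression. -/
lemma exists_progression_length (T d t₀ : ℕ) (ht : t₀ < d) :
    ∃ U : ℕ, (U : ℝ) ≤ T / d + 1 ∧ (T : ℝ) / d - 1 ≤ U ∧
      ∀ t, (t < T ∧ t % d = t₀) ↔ ∃ s < U, t = t₀ + d * s := by
  have hd : 0 < d := by omega
  have hd' : (0 : ℝ) < d := by exact_mod_cast hd
  obtain ⟨r, hr⟩ : ∃ r, r + t₀ + 1 = d := ⟨d - t₀ - 1, by omega⟩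
  refine ⟨(T + r) / d, ?_, ?_, fun t => ⟨fun ⟨h1, h2⟩ => ⟨t / d, ?_, ?_⟩, ?_⟩⟩
  · have h := Nat.cast_div_le (α := ℝ) (m := T + r) (n := d)
    refine h.trans ?_
    rw [div_add_one hd'.ne']
    gcongr
    exact_mod_cast (by omega : T + r ≤ T + d)
  · have h : (T + r) < d * ((T + r) / d + 1) := Nat.lt_mul_div_succ _ hd
    have h' : ((T : ℝ) + r) < d * (((T + r) / d : ℕ) + 1) := by exact_mod_cast h
    rw [sub_le_iff_le_add, div_le_iff₀ hd']
    have : (0 : ℝ) ≤ r := by positivity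
    nlinarith
  · rw [Nat.lt_div_iff_mul_lt hd]
    have := Nat.div_add_mod t d
    rw [mul_comm]
    omega
  · have := Nat.div_add_mod t d
    omega
  · rintro ⟨s, hs, rfl⟩
    rw [Nat.lt_div_iff_mul_lt hd, mul_comm] at hs
    refine ⟨by omega, ?_⟩
    rw [Nat.add_mul_mod_self_left, Nat.mod_eq_of_lt ht]

lemma card_siftedSet_filter_mod (Q : Finset ℕ) (a b T d t₀ U : ℕ) (hd : 0 < d)
    (hU : ∀ t, (t < T ∧ t % d = t₀) ↔ ∃ s < U, t = t₀ + d * s) :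
    ((siftedSet Q a b T).filter fun t => t % d = t₀).card =
      (siftedSet Q (a + b * t₀) (b * d) U).card := by
  symm
  refine Finset.card_bij (fun s _ => t₀ + d * s) ?_ ?_ ?_
  · intro s hs
    simp only [siftedSet, Finset.mem_filter, Finset.mem_range] at hs ⊢
    have := (hU (t₀ + d * s)).2 ⟨s, hs.1, rfl⟩
    refine ⟨⟨this.1, fun q hq => ?_⟩, this.2⟩
    convert hs.2 q hq using 2
    ring
  · intro s _ s' _ h
    exact Nat.eq_of_mul_eq_mul_left hd (by omega)
  · intro t ht
    simp only [siftedSet, Finset.mem_filter, Finset.mem_range] at ht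
    obtain ⟨s, hs, rfl⟩ := (hU t).1 ⟨ht.1.1, ht.2⟩
    refine ⟨s, ?_, rfl⟩
    simp only [siftedSet, Finset.mem_filter, Finset.mem_range]
    refine ⟨hs, fun q hq => ?_⟩
    convert ht.1.2 q hq using 2
    ring

lemma exists_dvd_progression_iff {q a b : ℕ} (hq : 0 < q) (hb : b.Coprime q) :
    ∃ t₀ < q, ∀ t, q ∣ a + b * t ↔ t % q = t₀ := by
  have key : ∀ t t', q ∣ a + b * t → (q ∣ a + b * t' ↔ t' % q = t % q) := by
    intro t t' h
    have h1 : a + b * t ≡ 0 [MOD q] := (Nat.modEq_zero_iff_dvd).2 h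
    constructor
    · intro h'
      have h2 : a + b * t' ≡ 0 [MOD q] := (Nat.modEq_zero_iff_dvd).2 h'
      have h3 := Nat.ModEq.add_left_cancel' a (h2.trans h1.symm)
      exact Nat.ModEq.cancel_left_of_coprime (by simpa [Nat.coprime_comm] using hb) h3
    · intro h'
      have h2 : t' ≡ t [MOD q] := h'
      exact (Nat.modEq_zero_iff_dvd).1 (((h2.mul_left b).add_left a).trans h1)
  obtain ⟨t, ht⟩ : ∃ t, q ∣ a + b * t := by
    obtain ⟨t, -, ht⟩ := Nat.exists_mul_mod_eq_of_coprime (q - a % q) hb hq.ne'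
    refine ⟨t, (Nat.modEq_zero_iff_dvd).1 ?_⟩
    have h1 : a + b * t ≡ a % q + (q - a % q) [MOD q] :=
      Nat.ModEq.add (Nat.mod_modEq a q).symm ht
    have h2 : a % q + (q - a % q) = q := by have := Nat.mod_lt a hq; omega
    rw [h2] at h1
    exact h1.trans (by simp [Nat.ModEq])
  exact ⟨t % q, Nat.mod_lt _ hq, fun t' => key t t' ht⟩

lemma siftedSet_insert (Q : Finset ℕ) (q a b T : ℕ) :
    (siftedSet (insert q Q) a b T).card + ((siftedSet Q a b T).filter fun t => q ∣ a + b * t).card =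
      (siftedSet Q a b T).card := by
  have h : siftedSet (insert q Q) a b T = (siftedSet Q a b T).filter fun t => ¬ q ∣ a + b * t := by
    ext t
    simp only [siftedSet, Finset.mem_filter, Finset.mem_insert, forall_eq_or_imp]
    tauto
  rw [h, add_comm, Finset.card_filter_add_card_filter_not]

/-- Legendre's sieve for an arithmetic progression. -/
lemma abs_card_siftedSet_sub_le (Q : Finset ℕ) (hQ : ∀ q ∈ Q, q.Prime) :
    ∀ a b T : ℕ, (∀ q ∈ Q, b.Coprime q) →
      |((siftedSet Q a b T).card : ℝ) - siftedDensity Q * T| ≤ 2 ^ Q.card - 1 := by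
  induction Q using Finset.induction_on with
  | empty => intro a b T _; simp [siftedSet, siftedDensity]
  | insert q Q hqQ ih =>
    intro a b T hb
    have hQ' : ∀ p ∈ Q, p.Prime := fun p hp => hQ p (Finset.mem_insert_of_mem hp)
    have hq : q.Prime := hQ q (Finset.mem_insert_self _ _)
    have hb' : ∀ p ∈ Q, b.Coprime p := fun p hp => hb p (Finset.mem_insert_of_mem hp)
    obtain ⟨t₀, ht₀, ht⟩ := exists_dvd_progression_iff (a := a) hq.pos (hb q (Finset.mem_insert_self _ _))
    obtain ⟨U, hU1, hU2, hU⟩ := exists_progression_length T q t₀ ht₀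
    have h1 := siftedSet_insert Q q a b T
    have h2 : ((siftedSet Q a b T).filter fun t => q ∣ a + b * t).card =
        (siftedSet Q (a + b * t₀) (b * q) U).card := by
      simp_rw [ht]
      exact card_siftedSet_filter_mod Q a b T q t₀ U hq.pos hU
    have h3 := ih hQ' a b T hb'
    have h4 := ih hQ' (a + b * t₀) (b * q) U fun p hp => by
      refine Nat.Coprime.mul_left (hb' p hp) ((Nat.coprime_primes hq (hQ' p hp)).2 ?_)
      rintro rfl
      exact hqQ hp
    rw [h2] at h1
    have h1' : ((siftedSet (insert q Q) a b T).card : ℝ) +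
        (siftedSet Q (a + b * t₀) (b * q) U).card = (siftedSet Q a b T).card := by
      exact_mod_cast h1
    have hd : siftedDensity (insert q Q) = (1 - 1 / (q : ℝ)) * siftedDensity Q := by
      simp [siftedDensity, Finset.prod_insert hqQ]
    have hρ := siftedDensity_pos hQ'
    have hρ1 := siftedDensity_le_one hQ'
    rw [Finset.card_insert_of_notMem hqQ, hd, pow_succ]
    rw [abs_le] at h3 h4 ⊢
    have e1 : (1 - 1 / (q : ℝ)) * siftedDensity Q * T =
        siftedDensity Q * T - siftedDensity Q * (T / q) := by ring
    rw [e1]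
    have e2 : siftedDensity Q * U ≤ siftedDensity Q * (T / q) + 1 := by nlinarith
    have e3 : siftedDensity Q * (T / q) - 1 ≤ siftedDensity Q * U := by nlinarith
    constructor <;> linarith

lemma le_card_siftedSet {Q : Finset ℕ} (hQ : ∀ q ∈ Q, q.Prime) (a b T : ℕ)
    (hb : ∀ q ∈ Q, b.Coprime q) :
    siftedDensity Q * T - (2 ^ Q.card - 1) ≤ (siftedSet Q a b T).card := by
  have := (abs_le.1 (abs_card_siftedSet_sub_le Q hQ a b T hb)).1
  linarith

lemma card_siftedSet_le {Q : Finset ℕ} (hQ : ∀ q ∈ Q, q.Prime) (a b T : ℕ)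
    (hb : ∀ q ∈ Q, b.Coprime q) :
    ((siftedSet Q a b T).card : ℝ) ≤ siftedDensity Q * T + (2 ^ Q.card - 1) := by
  have := (abs_le.1 (abs_card_siftedSet_sub_le Q hQ a b T hb)).2
  linarith

lemma card_siftedSet_filter_mod_le {Q : Finset ℕ} (hQ : ∀ q ∈ Q, q.Prime) (a b T d t₀ : ℕ)
    (hb : ∀ q ∈ Q, b.Coprime q) (hd : ∀ q ∈ Q, d.Coprime q) (ht₀ : t₀ < d) :
    (((siftedSet Q a b T).filter fun t => t % d = t₀).card : ℝ) ≤
      siftedDensity Q * T / d + 2 ^ Q.card := by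
  obtain ⟨U, hU1, hU2, hU⟩ := exists_progression_length T d t₀ ht₀
  rw [card_siftedSet_filter_mod Q a b T d t₀ U (by omega) hU]
  have h := card_siftedSet_le hQ (a + b * t₀) (b * d) U fun q hq =>
    Nat.Coprime.mul_left (hb q hq) (hd q hq)
  have hρ := siftedDensity_pos hQ
  have hρ1 := siftedDensity_le_one hQ
  have : siftedDensity Q * U ≤ siftedDensity Q * (T / d + 1) := by gcongr
  rw [mul_div_assoc]
  linarith

lemma sq_dvd_sub_or_dvd_add {p n x y : ℕ} (hp : p.Prime) (hp2 : p ≠ 2) (hpn : ¬ p ∣ n)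
    (hx : x ^ 2 ≤ n) (hy : y ^ 2 ≤ n) (hpx : p ^ 2 ∣ n - x ^ 2) (hpy : p ^ 2 ∣ n - y ^ 2) :
    (x ≡ y [MOD p ^ 2]) ∨ p ^ 2 ∣ x + y := by
  have hpZ : Prime (p : ℤ) := Nat.prime_iff_prime_int.1 hp
  have e1 : ((p : ℤ) ^ 2) ∣ n - (x : ℤ) ^ 2 := by
    have := Int.natCast_dvd_natCast.2 hpx
    rwa [Nat.cast_sub hx, Nat.cast_pow, Nat.cast_pow] at this
  have e2 : ((p : ℤ) ^ 2) ∣ n - (y : ℤ) ^ 2 := by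
    have := Int.natCast_dvd_natCast.2 hpy
    rwa [Nat.cast_sub hy, Nat.cast_pow, Nat.cast_pow] at this
  have e3 : ((p : ℤ) ^ 2) ∣ (x + y) * (y - x) := by
    have := dvd_sub e1 e2
    have e : ((n : ℤ) - (x : ℤ) ^ 2) - (n - (y : ℤ) ^ 2) = (x + y) * (y - x) := by ring
    rwa [e] at this
  by_cases h : (p : ℤ) ∣ x + y
  · right
    have h' : ¬ (p : ℤ) ∣ y - x := by
      intro h'
      have h3 : (p : ℤ) ∣ 2 * y := by
        have := dvd_add h h'
        have e : (x : ℤ) + y + (y - x) = 2 * y := by ring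
        rwa [e] at this
      rcases hpZ.dvd_or_dvd h3 with h4 | h4
      · have : p ∣ 2 := by exact_mod_cast h4
        exact hp2 ((Nat.prime_dvd_prime_iff_eq hp Nat.prime_two).1 this)
      · apply hpn
        have h5 : (p : ℤ) ∣ (n - (y : ℤ) ^ 2) + (y : ℤ) ^ 2 :=
          dvd_add ((dvd_pow_self _ two_ne_zero).trans e2) (h4.trans (dvd_pow_self _ two_ne_zero))
        rw [sub_add_cancel] at h5
        exact_mod_cast h5
    have hc : IsCoprime ((p : ℤ) ^ 2) (y - x) :=
      ((Prime.coprime_iff_not_dvd hpZ).2 h').pow_left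
    have := hc.dvd_of_dvd_mul_right e3
    exact_mod_cast this
  · left
    have hc : IsCoprime ((p : ℤ) ^ 2) (x + y) :=
      ((Prime.coprime_iff_not_dvd hpZ).2 h).pow_left
    have := hc.dvd_of_dvd_mul_left e3
    rw [Nat.modEq_iff_dvd]
    exact_mod_cast this

/-- Odd primes whose square divides `n`. -/
def oddSquarePrimes (n : ℕ) : Finset ℕ :=
  n.primeFactors.filter fun q => q ≠ 2 ∧ q ^ 2 ∣ n

/-- Odd primes up to `Y` not dividing `n`. -/
def oddPrimesUpTo (Y n : ℕ) : Finset ℕ :=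
  (Finset.range (Y + 1)).filter fun p => p.Prime ∧ p ≠ 2 ∧ ¬ p ∣ n

open Classical in
/-- Primes in `(Y, N]` not dividing `n` whose square divides some `n - (a + b * t) ^ 2`. -/
noncomputable def largeSquarePrimes (n N a b T Y : ℕ) : Finset ℕ :=
  (Finset.range (N + 1)).filter fun p =>
    p.Prime ∧ Y < p ∧ ¬ p ∣ n ∧ ∃ t < T, p ^ 2 ∣ n - (a + b * t) ^ 2

/-- The standing situation of the sieve argument: a progression of `x = a + b * t` for which every
`n - x ^ 2` is divisible by the square of an odd prime. -/
structure SieveData (n N a b T Y : ℕ) : Prop where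
  pos : 0 < n
  le_sq : n ≤ N ^ 2
  step : b = 1 ∨ b = 2
  sq_lt : ∀ t < T, (a + b * t) ^ 2 < n
  lt : ∀ t < T, a + b * t < N
  bad : ∀ t < T, ∃ p : ℕ, p.Prime ∧ p ≠ 2 ∧ p ^ 2 ∣ n - (a + b * t) ^ 2
  two_mul_lt : 2 * N < (Y + 1) ^ 2
  sq_le : Y ^ 2 ≤ 2 * N
  two_le : 2 ≤ Y

lemma mem_oddSquarePrimes {n q : ℕ} (hn : 0 < n) :
    q ∈ oddSquarePrimes n ↔ q.Prime ∧ q ≠ 2 ∧ q ^ 2 ∣ n := by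
  simp only [oddSquarePrimes, Finset.mem_filter, Nat.mem_primeFactors]
  constructor
  · tauto
  · rintro ⟨h1, h2, h3⟩
    exact ⟨⟨h1, (dvd_pow_self _ two_ne_zero).trans h3, hn.ne'⟩, h2, h3⟩

section

variable {n N a b T Y : ℕ}

lemma card_filter_sq_dvd_le (hb : b = 1 ∨ b = 2) (hlt : ∀ t < T, (a + b * t) ^ 2 < n)
    {Q : Finset ℕ} (hQ : ∀ q ∈ Q, q.Prime ∧ q ≠ 2 ∧ q ∣ n) {p : ℕ} (hp : p.Prime) (hp2 : p ≠ 2)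
    (hpn : ¬ p ∣ n) :
    (((siftedSet Q a b T).filter fun t => p ^ 2 ∣ n - (a + b * t) ^ 2).card : ℝ) ≤
      2 * (siftedDensity Q * T / p ^ 2 + 2 ^ Q.card) := by
  have hcop : ∀ q : ℕ, q.Prime → q ≠ 2 → b.Coprime q := by
    rintro q h1 h2
    rcases hb with rfl | rfl
    · simp
    · exact (Nat.coprime_primes Nat.prime_two h1).2 (Ne.symm h2)
  have hρ := siftedDensity_pos fun q hq => (hQ q hq).1
  rcases Finset.eq_empty_or_nonempty
    ((siftedSet Q a b T).filter fun t => p ^ 2 ∣ n - (a + b * t) ^ 2) with h | ⟨t₁, h⟩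
  · rw [h]
    simp only [Finset.card_empty, Nat.cast_zero]
    positivity
  simp only [siftedSet, Finset.mem_filter, Finset.mem_range] at h
  have hpos : 0 < p ^ 2 := pow_pos hp.pos 2
  have hbp : b.Coprime (p ^ 2) := (hcop p hp hp2).pow_right 2
  obtain ⟨t₂, ht₂, h₂⟩ := exists_dvd_progression_iff (a := a + (a + b * t₁)) hpos hbp
  have hsub : ((siftedSet Q a b T).filter fun t => p ^ 2 ∣ n - (a + b * t) ^ 2) ⊆
      ((siftedSet Q a b T).filter fun t => t % p ^ 2 = t₁ % p ^ 2) ∪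
      ((siftedSet Q a b T).filter fun t => t % p ^ 2 = t₂) := by
    intro t ht
    rw [Finset.mem_filter] at ht
    have htT : t < T := by
      have := ht.1
      simp only [siftedSet, Finset.mem_filter, Finset.mem_range] at this
      exact this.1
    rw [Finset.mem_union, Finset.mem_filter, Finset.mem_filter]
    rcases sq_dvd_sub_or_dvd_add hp hp2 hpn (hlt t htT).le (hlt t₁ h.1.1).le ht.2 h.2 with h3 | h3
    · left
      refine ⟨ht.1, ?_⟩
      exact Nat.ModEq.cancel_left_of_coprime (by simpa [Nat.coprime_comm] using hbp)
        (Nat.ModEq.add_left_cancel' a h3)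
    · right
      refine ⟨ht.1, (h₂ t).1 ?_⟩
      convert h3 using 1
      ring
  have hd : ∀ q ∈ Q, (p ^ 2).Coprime q := fun q hq => by
    refine Nat.Coprime.pow_left 2 ((Nat.coprime_primes hp (hQ q hq).1).2 ?_)
    rintro rfl
    exact hpn (hQ p hq).2.2
  have hbQ : ∀ q ∈ Q, b.Coprime q := fun q hq => hcop q (hQ q hq).1 (hQ q hq).2.1
  have c1 := card_siftedSet_filter_mod_le (fun q hq => (hQ q hq).1) a b T (p ^ 2) (t₁ % p ^ 2)
    hbQ hd (Nat.mod_lt _ hpos)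
  have c2 := card_siftedSet_filter_mod_le (fun q hq => (hQ q hq).1) a b T (p ^ 2) t₂ hbQ hd ht₂
  have c3 : (((siftedSet Q a b T).filter fun t => p ^ 2 ∣ n - (a + b * t) ^ 2).card : ℝ) ≤ _ :=
    Nat.cast_le.2 ((Finset.card_le_card hsub).trans (Finset.card_union_le _ _))
  push_cast at c1 c2 c3
  linarith

lemma card_filter_sq_dvd_le_one (hb : b = 1 ∨ b = 2) (hlt : ∀ t < T, (a + b * t) ^ 2 < n)
    (hltN : ∀ t < T, a + b * t < N) (hY : 2 * N < (Y + 1) ^ 2) (Q : Finset ℕ)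
    {p : ℕ} (hp : p.Prime) (hp2 : p ≠ 2) (hpn : ¬ p ∣ n) (hpY : Y < p) :
    ((siftedSet Q a b T).filter fun t => p ^ 2 ∣ n - (a + b * t) ^ 2).card ≤ 1 := by
  rw [Finset.card_le_one]
  intro t ht s hs
  simp only [siftedSet, Finset.mem_filter, Finset.mem_range] at ht hs
  have hp2' : 2 * N < p ^ 2 := hY.trans_le (Nat.pow_le_pow_left hpY 2)
  have ht' := hltN t ht.1.1
  have hs' := hltN s hs.1.1
  have heq : a + b * t = a + b * s := by
    rcases sq_dvd_sub_or_dvd_add hp hp2 hpn (hlt t ht.1.1).le (hlt s hs.1.1).le ht.2 hs.2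
      with h | h
    · exact Nat.ModEq.eq_of_lt_of_lt h (by omega) (by omega)
    · have := Nat.eq_zero_of_dvd_of_lt h (by omega)
      omega
  have hb0 : 0 < b := by omega
  exact Nat.eq_of_mul_eq_mul_left hb0 (by omega)

lemma card_filter_dvd_le (hb : b = 1 ∨ b = 2)
    {Q : Finset ℕ} (hQ : ∀ q ∈ Q, q.Prime ∧ q ≠ 2 ∧ q ∣ n) {p : ℕ} (hp : p.Prime) (hp2 : p ≠ 2)
    (hpQ : p ∉ Q) :
    (((siftedSet Q a b T).filter fun t => p ∣ a + b * t).card : ℝ) ≤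
      siftedDensity Q * T / p + 2 ^ Q.card := by
  have hcop : ∀ q : ℕ, q.Prime → q ≠ 2 → b.Coprime q := by
    rintro q h1 h2
    rcases hb with rfl | rfl
    · simp
    · exact (Nat.coprime_primes Nat.prime_two h1).2 (Ne.symm h2)
  obtain ⟨t₂, ht₂, h₂⟩ := exists_dvd_progression_iff (a := a) hp.pos (hcop p hp hp2)
  simp_rw [h₂]
  refine card_siftedSet_filter_mod_le (fun q hq => (hQ q hq).1) a b T p t₂
    (fun q hq => hcop q (hQ q hq).1 (hQ q hq).2.1) (fun q hq => ?_) ht₂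
  refine (Nat.coprime_primes hp (hQ q hq).1).2 ?_
  rintro rfl
  exact hpQ hq

/-- If every `n - (a + b * t) ^ 2` is divisible by the square of an odd prime, then counting the
indices that survive sieving by `Q` gives this inequality. -/
lemma SieveData.sieve_inequality (h : SieveData n N a b T Y)
    {Q : Finset ℕ} (hQ : Q ⊆ oddSquarePrimes n) :
    siftedDensity Q * T - (2 ^ Q.card - 1) ≤
      ∑ q ∈ oddSquarePrimes n \ Q, (siftedDensity Q * T / q + 2 ^ Q.card) +
      ∑ p ∈ oddPrimesUpTo Y n, 2 * (siftedDensity Q * T / p ^ 2 + 2 ^ Q.card) +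
      (largeSquarePrimes n N a b T Y).card := by
  obtain ⟨hn, hnN, hb, hlt, hltN, hbad, hY, -, hY2⟩ := h
  have hQ' : ∀ q ∈ Q, q.Prime ∧ q ≠ 2 ∧ q ∣ n := fun q hq => by
    obtain ⟨h1, h2, h3⟩ := (mem_oddSquarePrimes hn).1 (hQ hq)
    exact ⟨h1, h2, (dvd_pow_self _ two_ne_zero).trans h3⟩
  have hbQ : ∀ q ∈ Q, b.Coprime q := fun q hq => by
    rcases hb with rfl | rfl
    · simp
    · exact (Nat.coprime_primes Nat.prime_two (hQ' q hq).1).2 (Ne.symm (hQ' q hq).2.1)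
  have hsub : siftedSet Q a b T ⊆
      ((oddSquarePrimes n \ Q).biUnion fun q =>
        (siftedSet Q a b T).filter fun t => q ∣ a + b * t) ∪
      ((oddPrimesUpTo Y n).biUnion fun p =>
        (siftedSet Q a b T).filter fun t => p ^ 2 ∣ n - (a + b * t) ^ 2) ∪
      ((largeSquarePrimes n N a b T Y).biUnion fun p =>
        (siftedSet Q a b T).filter fun t => p ^ 2 ∣ n - (a + b * t) ^ 2) := by
    intro t ht
    have ht' := ht
    simp only [siftedSet, Finset.mem_filter, Finset.mem_range] at ht'
    obtain ⟨p, hp, hp2, hpd⟩ := hbad t ht'.1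
    have hltt := hlt t ht'.1
    rw [Finset.mem_union, Finset.mem_union, Finset.mem_biUnion, Finset.mem_biUnion,
      Finset.mem_biUnion]
    by_cases hpn : p ∣ n
    · left; left
      have h1 : p ∣ a + b * t := by
        have h2 : p ∣ (a + b * t) ^ 2 := by
          have h3 := (Nat.dvd_sub_iff_right hltt.le hpn).1
            ((dvd_pow_self _ two_ne_zero).trans hpd)
          exact h3
        exact hp.dvd_of_dvd_pow h2
      have h4 : p ^ 2 ∣ n := by
        have := dvd_add hpd (pow_dvd_pow_of_dvd h1 2)
        rwa [Nat.sub_add_cancel hltt.le] at this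
      refine ⟨p, ?_, Finset.mem_filter.2 ⟨ht, h1⟩⟩
      rw [Finset.mem_sdiff, mem_oddSquarePrimes hn]
      exact ⟨⟨hp, hp2, h4⟩, fun h => ht'.2 p h h1⟩
    · by_cases hpY : p ≤ Y
      · left; right
        refine ⟨p, ?_, Finset.mem_filter.2 ⟨ht, hpd⟩⟩
        simp only [oddPrimesUpTo, Finset.mem_filter, Finset.mem_range]
        exact ⟨by omega, hp, hp2, hpn⟩
      · right
        refine ⟨p, ?_, Finset.mem_filter.2 ⟨ht, hpd⟩⟩
        simp only [largeSquarePrimes, Finset.mem_filter, Finset.mem_range]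
        refine ⟨?_, hp, by omega, hpn, t, ht'.1, hpd⟩
        have h1 : p ^ 2 ≤ N ^ 2 :=
          ((Nat.le_of_dvd (by omega) hpd).trans (Nat.sub_le _ _)).trans hnN
        have := (Nat.pow_le_pow_iff_left two_ne_zero).1 h1
        omega
  have c0 := le_card_siftedSet (fun q hq => (hQ' q hq).1) a b T hbQ
  have c1 : ((siftedSet Q a b T).card : ℝ) ≤ _ := Nat.cast_le.2
    ((Finset.card_le_card hsub).trans ((Finset.card_union_le _ _).trans
      (Nat.add_le_add_right (Finset.card_union_le _ _) _)))
  refine c0.trans (c1.trans ?_)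
  push_cast
  refine add_le_add (add_le_add ?_ ?_) ?_
  · refine (Nat.cast_le.2 Finset.card_biUnion_le).trans ?_
    push_cast
    refine Finset.sum_le_sum fun q hq => ?_
    rw [Finset.mem_sdiff, mem_oddSquarePrimes hn] at hq
    exact card_filter_dvd_le hb hQ' hq.1.1 hq.1.2.1 hq.2
  · refine (Nat.cast_le.2 Finset.card_biUnion_le).trans ?_
    push_cast
    refine Finset.sum_le_sum fun p hp => ?_
    simp only [oddPrimesUpTo, Finset.mem_filter, Finset.mem_range] at hp
    exact card_filter_sq_dvd_le hb hlt hQ' hp.2.1 hp.2.2.1 hp.2.2.2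
  · refine (Nat.cast_le.2 Finset.card_biUnion_le).trans ?_
    rw [Finset.card_eq_sum_ones]
    refine Nat.cast_le.2 (Finset.sum_le_sum fun p hp => ?_)
    simp only [largeSquarePrimes, Finset.mem_filter, Finset.mem_range] at hp
    exact card_filter_sq_dvd_le_one hb hlt hltN hY Q hp.2.1 (by omega) hp.2.2.2.1 hp.2.2.1

end

lemma sum_two_div_sq_le {A : Finset ℕ} (hA : ∀ p ∈ A, p.Prime ∧ p ≠ 2) :
    ∑ p ∈ A, 2 / (p : ℝ) ^ 2 ≤ 0.411 := by
  classical
  have tail : ∀ M : ℕ, ∑ i ∈ Finset.range M, 2 / ((101 + 2 * i : ℕ) : ℝ) ^ 2 ≤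
      1 / 100 - 1 / (100 + 2 * (M : ℝ)) := by
    intro M
    induction M with
    | zero => norm_num
    | succ M ih =>
      rw [Finset.sum_range_succ]
      have : 2 / ((101 + 2 * M : ℕ) : ℝ) ^ 2 ≤
          1 / (100 + 2 * (M : ℝ)) - 1 / (100 + 2 * ((M + 1 : ℕ) : ℝ)) := by
        push_cast
        rw [div_sub_div _ _ (by positivity) (by positivity),
          div_le_div_iff₀ (by positivity) (by positivity)]
        nlinarith
      linarith
  obtain ⟨M, hM⟩ : ∃ M : ℕ, ∀ p ∈ A, p ≤ M := ⟨A.sup id, fun p hp => Finset.le_sup (f := id) hp⟩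
  set S : Finset ℕ := {3, 5, 7, 11, 13, 17, 19, 23, 29, 31, 37, 41, 43, 47, 53, 59, 61, 67, 71, 73,
    79, 83, 89, 97} with hS
  have hsub : A ⊆ S ∪ (Finset.range M).image fun i => 101 + 2 * i := by
    intro p hp
    obtain ⟨h1, h2⟩ := hA p hp
    have h3 := hM p hp
    rw [Finset.mem_union]
    by_cases h : p < 100
    · left
      have : ∀ p < 100, p.Prime → p ≠ 2 → p ∈ S := by rw [hS]; decide +kernel
      exact this p h h1 h2
    · right
      have := h1.eq_two_or_odd
      rw [Finset.mem_image]
      exact ⟨(p - 101) / 2, by rw [Finset.mem_range]; omega, by omega⟩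
  set B : Finset ℕ := (Finset.range M).image fun i => 101 + 2 * i with hB
  have hS' : ∑ p ∈ S, 2 / (p : ℝ) ^ 2 ≤ 0.401 := by
    rw [hS]
    norm_num
  have hT : ∑ p ∈ B, 2 / (p : ℝ) ^ 2 ≤ 0.01 := by
    rw [hB, Finset.sum_image (by intro i _ j _ h; simp only at h; omega)]
    refine (tail M).trans ?_
    have : (0 : ℝ) ≤ 1 / (100 + 2 * (M : ℝ)) := by positivity
    norm_num at this ⊢
    linarith
  calc ∑ p ∈ A, 2 / (p : ℝ) ^ 2
      ≤ ∑ p ∈ S ∪ B, 2 / (p : ℝ) ^ 2 :=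
        Finset.sum_le_sum_of_subset_of_nonneg hsub fun _ _ _ => by positivity
    _ ≤ ∑ p ∈ S, 2 / (p : ℝ) ^ 2 +
        ∑ p ∈ B, 2 / (p : ℝ) ^ 2 := by
      rw [← Finset.sum_union_inter]
      exact le_add_of_nonneg_right (Finset.sum_nonneg fun _ _ => by positivity)
    _ ≤ 0.411 := by linarith

/-- The number of primes below `n`. -/
@[irreducible]
def primeCount (n : ℕ) : ℕ := n.primesBelow.card

lemma primeCount_eq (n : ℕ) : primeCount n = n.primesBelow.card := by rw [primeCount]

lemma primeCount_mul_le (k u : ℕ) :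
    k * primeCount (u + 1) ≤ 2 * u + ∑ i ∈ Finset.Icc 1 k, primeCount (2 ^ i) := by
  have h1 : ∑ p ∈ (u + 1).primesBelow, Nat.log 2 p ≤ 2 * u := by
    have h : 2 ^ ∑ p ∈ (u + 1).primesBelow, Nat.log 2 p ≤ 2 ^ (2 * u) := by
      rw [← Finset.prod_pow_eq_pow_sum, pow_mul]
      refine le_trans ?_ (primorial_le_four_pow u)
      rw [primorial]
      refine Finset.prod_le_prod' fun p hp => ?_
      exact Nat.pow_log_le_self 2 (Nat.prime_of_mem_primesBelow hp).pos.ne'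
    exact (Nat.pow_le_pow_iff_right (by norm_num)).1 h
  have h2 : ∀ p ∈ (u + 1).primesBelow,
      k ≤ Nat.log 2 p + ((Finset.Icc 1 k).filter fun i => p < 2 ^ i).card := by
    intro p _
    have hsub : Finset.Icc (Nat.log 2 p + 1) k ⊆ (Finset.Icc 1 k).filter fun i => p < 2 ^ i := by
      intro i hi
      rw [Finset.mem_Icc] at hi
      rw [Finset.mem_filter, Finset.mem_Icc]
      exact ⟨⟨by omega, hi.2⟩, Nat.lt_pow_of_log_lt (by norm_num) (by omega)⟩
    have := Finset.card_le_card hsub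
    rw [Nat.card_Icc] at this
    omega
  have h3 : ∑ p ∈ (u + 1).primesBelow, ((Finset.Icc 1 k).filter fun i => p < 2 ^ i).card ≤
      ∑ i ∈ Finset.Icc 1 k, primeCount (2 ^ i) := by
    simp_rw [primeCount_eq, Finset.card_filter]
    rw [Finset.sum_comm]
    refine Finset.sum_le_sum fun i _ => ?_
    rw [← Finset.card_filter]
    refine Finset.card_le_card fun p hp => ?_
    rw [Finset.mem_filter] at hp
    exact Nat.mem_primesBelow.2 ⟨hp.2, Nat.prime_of_mem_primesBelow hp.1⟩
  have h4 := Finset.sum_le_sum h2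
  rw [Finset.sum_const, smul_eq_mul, Finset.sum_add_distrib] at h4
  rw [mul_comm, primeCount_eq]
  omega

/-- The product of the primes below `100`. -/
def smallPrimorial : ℕ := 2305567963945518424753102147331756070

/-- The number of integers in `[lo, lo + 2 ^ k)` without prime factor below `100`. -/
def roughCount : ℕ → ℕ → ℕ
  | 0, lo => bif Nat.beq (Nat.gcd lo smallPrimorial) 1 then 1 else 0
  | k + 1, lo => roughCount k lo + roughCount k (lo + 2 ^ k)

lemma Nat.Prime.coprime_smallPrimorial {p : ℕ} (hp : p.Prime) (h : 100 ≤ p) :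
    Nat.gcd p smallPrimorial = 1 := by
  have e : smallPrimorial = 2 * 3 * 5 * 7 * 11 * 13 * 17 * 19 * 23 * 29 * 31 * 37 * 41 * 43 * 47 *
    53 * 59 * 61 * 67 * 71 * 73 * 79 * 83 * 89 * 97 := by decide +kernel
  have key : ∀ q : ℕ, q.Prime → q < 100 → Nat.Coprime p q := fun q hq hlt =>
    (Nat.coprime_primes hp hq).2 (by omega)
  rw [e]
  iterate 24 apply Nat.Coprime.mul_right
  all_goals exact key _ (by norm_num) (by norm_num)

lemma card_filter_prime_Ico_le (k lo : ℕ) (h : 100 ≤ lo) :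
    ((Finset.Ico lo (lo + 2 ^ k)).filter Nat.Prime).card ≤ roughCount k lo := by
  induction k generalizing lo with
  | zero =>
    simp only [pow_zero, Nat.Ico_succ_singleton, roughCount, Finset.filter_singleton]
    split_ifs with hp
    · simp [hp.coprime_smallPrimorial h]
    · simp
  | succ k ih =>
    rw [roughCount]
    refine le_trans ?_ (Nat.add_le_add (ih lo h) (ih (lo + 2 ^ k) (h.trans (Nat.le_add_right _ _))))
    refine le_trans (Finset.card_le_card ?_) (Finset.card_union_le _ _)
    intro p hp
    simp only [Finset.mem_union, Finset.mem_filter, Finset.mem_Ico, pow_succ] at hp ⊢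
    rcases lt_or_ge p (lo + 2 ^ k) with h | h
    · left; exact ⟨⟨hp.1.1, h⟩, hp.2⟩
    · right; exact ⟨⟨h, by omega⟩, hp.2⟩

lemma primeCount_add_le (k lo c : ℕ) (h : 100 ≤ lo) (hc : roughCount k lo ≤ c) :
    primeCount (lo + 2 ^ k) ≤ primeCount lo + c := by
  rw [primeCount_eq, primeCount_eq]
  refine le_trans (Finset.card_le_card (t := lo.primesBelow ∪
    (Finset.Ico lo (lo + 2 ^ k)).filter Nat.Prime) ?_) ((Finset.card_union_le _ _).trans
    (Nat.add_le_add_left ((card_filter_prime_Ico_le k lo h).trans hc) _))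
  intro p hp
  rw [Nat.mem_primesBelow] at hp
  simp only [Finset.mem_union, Nat.mem_primesBelow, Finset.mem_filter, Finset.mem_Ico]
  by_cases h : p < lo
  · exact Or.inl ⟨h, hp.2⟩
  · exact Or.inr ⟨⟨by omega, hp.1⟩, hp.2⟩

lemma primeCount_two_pow_le : ∀ i ∈ Finset.Icc 1 13, primeCount (2 ^ i) ≤
    [0, 0, 2, 4, 6, 11, 18, 31, 54, 97, 172, 309, 564, 1028].getD i 0 := by
  have h7 : primeCount (2 ^ 7) ≤ 31 := by rw [primeCount_eq]; decide +kernel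
  have h8 := primeCount_add_le 7 (2 ^ 7) 23 (by norm_num) (by decide +kernel)
  have h9 := primeCount_add_le 8 (2 ^ 8) 43 (by norm_num) (by decide +kernel)
  have h10 := primeCount_add_le 9 (2 ^ 9) 75 (by norm_num) (by decide +kernel)
  have h11 := primeCount_add_le 10 (2 ^ 10) 137 (by norm_num) (by decide +kernel)
  have h12 := primeCount_add_le 11 (2 ^ 11) 255 (by norm_num) (by decide +kernel)
  have h13 := primeCount_add_le 12 (2 ^ 12) 464 (by norm_num) (by decide +kernel)
  norm_num only at h7 h8 h9 h10 h11 h12 h13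
  intro i hi
  rw [Finset.mem_Icc] at hi
  obtain ⟨hi1, hi2⟩ := hi
  interval_cases i
  iterate 6 · rw [primeCount_eq]; decide +kernel
  all_goals norm_num only [List.getD_cons_zero, List.getD_cons_succ]
  all_goals omega

lemma primeCount_mono {u v : ℕ} (h : u ≤ v) :
    primeCount u ≤ primeCount v := by
  rw [primeCount_eq, primeCount_eq]
  exact Finset.card_le_card fun p hp => by
    rw [Nat.mem_primesBelow] at hp ⊢
    exact ⟨hp.1.trans_le h, hp.2⟩

/-- The sum of the numbers of primes below `2 ^ i` for `i ≤ k`. -/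
def dyadicPrimeCount (k : ℕ) : ℕ := ∑ i ∈ Finset.Icc 1 k, primeCount (2 ^ i)

lemma mul_primeCount_le (k u : ℕ) : k * primeCount (u + 1) ≤ 2 * u + dyadicPrimeCount k :=
  primeCount_mul_le k u

lemma dyadicPrimeCount_succ (k : ℕ) :
    dyadicPrimeCount (k + 1) = dyadicPrimeCount k + primeCount (2 ^ (k + 1)) := by
  rw [dyadicPrimeCount, Finset.sum_Icc_succ_top (by omega), dyadicPrimeCount]

lemma dyadicPrimeCount_twelve : dyadicPrimeCount 12 ≤ 1268 := by
  refine (Finset.sum_le_sum fun i hi => primeCount_two_pow_le i ?_).trans (by decide)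
  rw [Finset.mem_Icc] at hi ⊢
  omega

lemma dyadicPrimeCount_thirteen : dyadicPrimeCount 13 ≤ 2296 :=
  (Finset.sum_le_sum fun i hi => primeCount_two_pow_le i hi).trans (by decide)

lemma mul_primeCount_two_pow_le (k i : ℕ) :
    k * primeCount (2 ^ i) ≤ 2 * 2 ^ i + dyadicPrimeCount k :=
  (Nat.mul_le_mul_left _ (primeCount_mono (Nat.le_succ _))).trans (mul_primeCount_le k (2 ^ i))

lemma dyadicPrimeCount_succ_le {k C j D : ℕ} (hD : dyadicPrimeCount j ≤ D) (hj : 0 < j)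
    (hC : dyadicPrimeCount k ≤ C) :
    dyadicPrimeCount (k + 1) ≤ C + (2 * 2 ^ (k + 1) + D) / j := by
  rw [dyadicPrimeCount_succ]
  refine Nat.add_le_add hC ((Nat.le_div_iff_mul_le hj).2 ?_)
  rw [mul_comm]
  exact (mul_primeCount_two_pow_le j (k + 1)).trans (Nat.add_le_add_left hD _)

lemma dyadicPrimeCount_sixteen : dyadicPrimeCount 16 ≤ 20472 := by
  have h := dyadicPrimeCount_thirteen
  have step := fun k C => @dyadicPrimeCount_succ_le k C 13 2296 h (by norm_num)
  exact (step 15 _ (step 14 _ (step 13 _ h))).trans (by norm_num)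

lemma dyadicPrimeCount_twentyfour : dyadicPrimeCount 24 ≤ 4231200 := by
  have h := dyadicPrimeCount_sixteen
  have step := fun k C => @dyadicPrimeCount_succ_le k C 16 20472 h (by norm_num)
  exact (step 23 _ (step 22 _ (step 21 _ (step 20 _ (step 19 _ (step 18 _ (step 17 _
    (step 16 _ h)))))))).trans (by norm_num)

lemma primeCount_le_of_lt {u : ℕ} (h1 : 4096 ≤ u) (h2 : u < 8192) :
    1000 * primeCount (u + 1) ≤ 168 * u := by
  have h12 := primeCount_two_pow_le 12 (by decide)
  have h5 := primeCount_add_le 10 (2 ^ 12) 121 (by norm_num) (by decide +kernel)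
  have h6 := primeCount_add_le 11 (2 ^ 12) 237 (by norm_num) (by decide +kernel)
  have h13 := primeCount_two_pow_le 13 (by decide)
  norm_num only [List.getD_cons_zero, List.getD_cons_succ] at h12 h5 h6 h13
  rcases lt_or_ge u 5120 with h | h
  · have := primeCount_mono (show u + 1 ≤ 5120 by omega)
    omega
  rcases lt_or_ge u 6144 with h' | h'
  · have := primeCount_mono (show u + 1 ≤ 6144 by omega)
    omega
  · have := primeCount_mono (show u + 1 ≤ 8192 by omega)
    omega

lemma prod_oddSquarePrimes_le {n N : ℕ} (hn : 0 < n) (hnN : n ≤ N ^ 2) :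
    ∏ q ∈ oddSquarePrimes n, q ≤ N := by
  have h : ∏ q ∈ oddSquarePrimes n, q ^ 2 ∣ n := by
    refine Finset.prod_dvd_of_isRelPrime ?_ fun q hq => ((mem_oddSquarePrimes hn).1 hq).2.2
    intro p hp q hq hpq
    rw [Function.onFun, ← Nat.coprime_iff_isRelPrime]
    exact Nat.Coprime.pow 2 2 ((Nat.coprime_primes ((mem_oddSquarePrimes hn).1 hp).1
      ((mem_oddSquarePrimes hn).1 hq).1).2 hpq)
  rw [Finset.prod_pow] at h
  exact (Nat.pow_le_pow_iff_left two_ne_zero).1 ((Nat.le_of_dvd hn h).trans hnN)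

lemma card_oddPrimesUpTo_le (Y n : ℕ) : ((oddPrimesUpTo Y n).card : ℝ) ≤ Y / 3 + 1 := by
  have h : (oddPrimesUpTo Y n).card ≤ Y / 3 + 1 := by
    rw [← Finset.card_range (Y / 3 + 1)]
    refine Finset.card_le_card_of_injOn (fun p => if p = 3 then 0 else p / 3) ?_ ?_
    · intro p hp
      simp only [oddPrimesUpTo, Finset.coe_filter, Finset.mem_range, Set.mem_ofPred_eq,
        Finset.coe_range, Set.mem_Iio] at hp ⊢
      split_ifs <;> omega
    · have key : ∀ p ∈ oddPrimesUpTo Y n, p = 3 ∨ (p % 2 = 1 ∧ p % 3 ≠ 0 ∧ 3 < p) := by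
        intro p hp
        simp only [oddPrimesUpTo, Finset.mem_filter, Finset.mem_range] at hp
        by_cases h3 : p = 3
        · exact Or.inl h3
        · have h1 := hp.2.1.eq_two_or_odd
          have h2 : p % 3 ≠ 0 := fun h0 => h3
            ((Nat.prime_dvd_prime_iff_eq Nat.prime_three hp.2.1).1 (Nat.dvd_of_mod_eq_zero h0)).symm
          have h4 := hp.2.1.two_le
          right
          omega
      intro p hp q hq hpq
      have h1 := key p hp
      have h2 := key q hq
      simp only at hpq
      split_ifs at hpq <;> omega
  have h' : ((oddPrimesUpTo Y n).card : ℝ) ≤ ((Y / 3 : ℕ) : ℝ) + 1 := by exact_mod_cast h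
  have h3 := Nat.cast_div_le (α := ℝ) (m := Y) (n := 3)
  push_cast at h3
  linarith

lemma card_le_of_prod_lt {I Q : Finset ℕ} {r : ℕ} (hI : ∀ i ∈ I, 0 < i ∧ i ≤ r) (hr : 0 < r)
    (hQ : ∀ q ∈ Q, q ∈ I ∨ r ≤ q) (h : ∏ q ∈ Q, q < r * ∏ i ∈ I, i) : Q.card ≤ I.card := by
  by_contra! hc
  have h1 : r ^ (Q \ I).card ≤ ∏ q ∈ Q \ I, q := by
    refine Finset.pow_card_le_prod _ _ _ fun q hq => ?_
    rw [Finset.mem_sdiff] at hq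
    exact (hQ q hq.1).resolve_left hq.2
  have h2 : ∏ i ∈ I \ Q, i ≤ r ^ (I \ Q).card := by
    refine Finset.prod_le_pow_card _ _ _ fun i hi => ?_
    exact (hI i (Finset.mem_sdiff.1 hi).1).2
  have h3 : (I \ Q).card + 1 ≤ (Q \ I).card := by
    have := Finset.card_sdiff_add_card_inter Q I
    have := Finset.card_sdiff_add_card_inter I Q
    rw [Finset.inter_comm] at this
    omega
  have h4 : r * ∏ i ∈ I \ Q, i ≤ ∏ q ∈ Q \ I, q := by
    refine le_trans ?_ ((Nat.pow_le_pow_right hr h3).trans h1)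
    rw [pow_succ, mul_comm]
    exact Nat.mul_le_mul_right _ h2
  refine absurd h (not_lt.2 ?_)
  rw [← Finset.prod_inter_mul_prod_sdiff Q I fun q => q,
    ← Finset.prod_inter_mul_prod_sdiff I Q fun i => i, Finset.inter_comm I Q, mul_left_comm]
  exact Nat.mul_le_mul_left _ h4

lemma sum_le_sum_of_card_le {I Q : Finset ℕ} {c : ℝ} {v : ℕ → ℝ} (hI : ∀ i ∈ I, c ≤ v i)
    (hQ : ∀ q ∈ Q, q ∈ I ∨ v q ≤ c) (hc : 0 ≤ c) (h : Q.card ≤ I.card) :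
    ∑ q ∈ Q, v q ≤ ∑ i ∈ I, v i := by
  have h1 : ∑ q ∈ Q \ I, v q ≤ (Q \ I).card * c := by
    rw [← nsmul_eq_mul]
    refine Finset.sum_le_card_nsmul _ _ _ fun q hq => ?_
    rw [Finset.mem_sdiff] at hq
    exact (hQ q hq.1).resolve_left hq.2
  have h2 : (I \ Q).card * c ≤ ∑ i ∈ I \ Q, v i := by
    rw [← nsmul_eq_mul]
    exact Finset.card_nsmul_le_sum _ _ _ fun i hi => hI i (Finset.mem_sdiff.1 hi).1
  have h3 : ((Q \ I).card : ℝ) ≤ (I \ Q).card := by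
    have := Finset.card_sdiff_add_card_inter Q I
    have := Finset.card_sdiff_add_card_inter I Q
    rw [Finset.inter_comm] at this
    exact_mod_cast (by omega : (Q \ I).card ≤ (I \ Q).card)
  have h4 : ((Q \ I).card : ℝ) * c ≤ (I \ Q).card * c := by gcongr
  have h5 := Finset.sum_inter_add_sum_sdiff Q I v
  have h6 := Finset.sum_inter_add_sum_sdiff I Q v
  rw [Finset.inter_comm] at h6
  linarith

lemma inv_sub_two_div_sq_antitone {p q : ℕ} (hp : 4 ≤ p) (hpq : p ≤ q) :
    1 / (q : ℝ) - 2 / (q : ℝ) ^ 2 ≤ 1 / (p : ℝ) - 2 / (p : ℝ) ^ 2 := by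
  have hp' : (4 : ℝ) ≤ p := by exact_mod_cast hp
  have hq' : (4 : ℝ) ≤ q := by exact_mod_cast hp.trans hpq
  have h1 : 1 / (q : ℝ) ≤ 1 / p := one_div_le_one_div_of_le (by linarith) (by exact_mod_cast hpq)
  have h2 : 1 / (p : ℝ) ≤ 1 / 4 := one_div_le_one_div_of_le (by linarith) hp'
  have e1 : 2 / (q : ℝ) ^ 2 = 2 * (1 / q) ^ 2 := by ring
  have e2 : 2 / (p : ℝ) ^ 2 = 2 * (1 / p) ^ 2 := by ring
  rw [e1, e2]
  have h3 : 0 ≤ 1 / (q : ℝ) := by positivity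
  nlinarith [mul_nonneg (sub_nonneg.2 h1) (by linarith : 0 ≤ 1 - 2 * (1 / (q : ℝ) + 1 / p))]

lemma inv_sub_two_div_sq_nonneg {p : ℕ} (hp : 4 ≤ p) : 0 ≤ 1 / (p : ℝ) - 2 / (p : ℝ) ^ 2 := by
  have hp' : (4 : ℝ) ≤ p := by exact_mod_cast hp
  have h2 : 1 / (p : ℝ) ≤ 1 / 4 := one_div_le_one_div_of_le (by linarith) hp'
  have e2 : 2 / (p : ℝ) ^ 2 = 2 * (1 / p) ^ 2 := by ring
  rw [e2]
  have h3 : 0 ≤ 1 / (p : ℝ) := by positivity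
  nlinarith

/-- The numerical form of the sieve inequality when at most `I.card` primes remain unsieved. -/
lemma SieveData.false_of_bounds {n N a b T Y r : ℕ} (h : SieveData n N a b T Y)
    (Q I : Finset ℕ) (hQ : Q ⊆ oddSquarePrimes n)
    (hI : ∀ i ∈ I, 5 ≤ i ∧ i ≤ r) (hr : 5 ≤ r)
    (hQI : ∀ q ∈ oddSquarePrimes n, q ∈ Q ∨ q ∈ I ∨ r ≤ q)
    (hprod : N < (∏ q ∈ Q, q) * (r * ∏ i ∈ I, i)) {L S : ℝ} (hS : 0 ≤ S)
    (hL : ((largeSquarePrimes n N a b T Y).card : ℝ) ≤ L) (hT : S ≤ T)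
    (hlarge : (2 ^ Q.card - 1) + 2 ^ Q.card * I.card + 2 * 2 ^ Q.card * ((Y : ℝ) / 3 + 1) + L <
      siftedDensity Q * S * (1 - 0.411 + ∑ q ∈ Q, 2 / (q : ℝ) ^ 2 -
        ∑ i ∈ I, (1 / (i : ℝ) - 2 / (i : ℝ) ^ 2))) : False := by
  have hn := h.pos
  have hnN := h.le_sq
  have hQp : ∀ q ∈ Q, q.Prime := fun q hq => ((mem_oddSquarePrimes hn).1 (hQ hq)).1
  have hρ := siftedDensity_pos hQp
  have hmain := h.sieve_inequality hQ
  have hcard : (oddSquarePrimes n \ Q).card ≤ I.card := by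
    refine card_le_of_prod_lt (r := r) (fun i hi => ⟨by have := (hI i hi).1; omega, (hI i hi).2⟩)
      (by omega) ?_ ?_
    · intro q hq
      rw [Finset.mem_sdiff] at hq
      exact (hQI q hq.1).resolve_left hq.2
    · have h1 := prod_oddSquarePrimes_le hn hnN
      rw [← Finset.prod_sdiff hQ, mul_comm] at h1
      exact lt_of_mul_lt_mul_left (h1.trans_lt hprod) (Nat.zero_le _)
  have hsum : ∑ q ∈ oddSquarePrimes n \ Q, (1 / (q : ℝ) - 2 / (q : ℝ) ^ 2) ≤
      ∑ i ∈ I, (1 / (i : ℝ) - 2 / (i : ℝ) ^ 2) := by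
    refine sum_le_sum_of_card_le (v := fun q : ℕ => 1 / (q : ℝ) - 2 / (q : ℝ) ^ 2)
      (c := 1 / (r : ℝ) - 2 / (r : ℝ) ^ 2) ?_ ?_ (inv_sub_two_div_sq_nonneg (by omega)) hcard
    · exact fun i hi => inv_sub_two_div_sq_antitone (by have := (hI i hi).1; omega) (hI i hi).2
    · intro q hq
      rw [Finset.mem_sdiff] at hq
      exact ((hQI q hq.1).resolve_left hq.2).imp_right fun h =>
        inv_sub_two_div_sq_antitone (by omega) h
  have hsq : ∑ p ∈ oddPrimesUpTo Y n, 2 / (p : ℝ) ^ 2 +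
      (∑ q ∈ oddSquarePrimes n \ Q, 2 / (q : ℝ) ^ 2 + ∑ q ∈ Q, 2 / (q : ℝ) ^ 2) ≤ 0.411 := by
    rw [Finset.sum_sdiff hQ, ← Finset.sum_union]
    · refine sum_two_div_sq_le fun p hp => ?_
      rw [Finset.mem_union, mem_oddSquarePrimes hn] at hp
      simp only [oddPrimesUpTo, Finset.mem_filter] at hp
      tauto
    · rw [Finset.disjoint_left]
      intro p hp hp'
      simp only [oddPrimesUpTo, Finset.mem_filter] at hp
      exact hp.2.2.2 ((dvd_pow_self _ two_ne_zero).trans ((mem_oddSquarePrimes hn).1 hp').2.2)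
  have hP := card_oddPrimesUpTo_le Y n
  rw [Finset.sum_sub_distrib] at hsum
  set R := siftedDensity Q * (T : ℝ) with hR
  have e1 : ∑ q ∈ oddSquarePrimes n \ Q, (R / (q : ℝ) + 2 ^ Q.card) =
      R * ∑ q ∈ oddSquarePrimes n \ Q, 1 / (q : ℝ) +
        (oddSquarePrimes n \ Q).card * 2 ^ Q.card := by
    rw [Finset.sum_add_distrib, Finset.mul_sum, Finset.sum_const, nsmul_eq_mul]
    congr 1
    exact Finset.sum_congr rfl fun _ _ => by ring
  have e2 : ∑ p ∈ oddPrimesUpTo Y n, 2 * (R / (p : ℝ) ^ 2 + 2 ^ Q.card) =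
      R * ∑ p ∈ oddPrimesUpTo Y n, 2 / (p : ℝ) ^ 2 +
        (oddPrimesUpTo Y n).card * (2 * 2 ^ Q.card) := by
    simp_rw [mul_add]
    rw [Finset.sum_add_distrib, Finset.mul_sum, Finset.sum_const, nsmul_eq_mul]
    congr 1
    exact Finset.sum_congr rfl fun _ _ => by ring
  rw [e1, e2] at hmain
  set δ : ℝ := 1 - 0.411 + ∑ q ∈ Q, 2 / (q : ℝ) ^ 2 -
    ∑ i ∈ I, (1 / (i : ℝ) - 2 / (i : ℝ) ^ 2) with hδ
  have hK : (1 : ℝ) ≤ 2 ^ Q.card := one_le_pow₀ (by norm_num)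
  have hcard' : ((oddSquarePrimes n \ Q).card : ℝ) ≤ I.card := by exact_mod_cast hcard
  have hR0 : 0 ≤ R := by positivity
  have hSR : siftedDensity Q * S ≤ R := by rw [hR]; gcongr
  have hL0 : (0 : ℝ) ≤ L := (Nat.cast_nonneg _).trans hL
  have hδ0 : 0 ≤ δ := by
    by_contra! hneg
    have h1 : siftedDensity Q * S * δ ≤ 0 :=
      mul_nonpos_of_nonneg_of_nonpos (by positivity) hneg.le
    have h2 : (0 : ℝ) ≤ (2 ^ Q.card - 1) + 2 ^ Q.card * I.card +
      2 * 2 ^ Q.card * ((Y : ℝ) / 3 + 1) + L := by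
      have : (0 : ℝ) ≤ 2 ^ Q.card - 1 := by linarith
      positivity
    linarith
  have f1 : ((oddSquarePrimes n \ Q).card : ℝ) * 2 ^ Q.card ≤ I.card * 2 ^ Q.card := by gcongr
  have f2 : ((oddPrimesUpTo Y n).card : ℝ) * (2 * 2 ^ Q.card) ≤
    ((Y : ℝ) / 3 + 1) * (2 * 2 ^ Q.card) := by gcongr
  have f3 : R * (∑ q ∈ oddSquarePrimes n \ Q, 1 / (q : ℝ) +
      ∑ p ∈ oddPrimesUpTo Y n, 2 / (p : ℝ) ^ 2) ≤ R * (1 - δ) := by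
    refine mul_le_mul_of_nonneg_left ?_ hR0
    rw [hδ]
    linarith
  have f4 : siftedDensity Q * S * δ ≤ R * δ := by gcongr
  linarith

lemma SieveData.false_of_le {n N a b T Y : ℕ} (h : SieveData n N a b T Y) (P : ℕ → Prop)
    (hP : ∀ q ∈ oddSquarePrimes n, P q) (Q I : Finset ℕ) (r : ℕ) (hQ : Q ⊆ oddSquarePrimes n)
    (hI : ∀ i ∈ I, 5 ≤ i ∧ i ≤ r) (hr : 5 ≤ r)
    (hQI : ∀ q < r, q.Prime → q ≠ 2 → P q → q ∈ Q ∨ q ∈ I) {H : ℕ} (hN : N ≤ H)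
    (hprod : H < (∏ q ∈ Q, q) * (r * ∏ i ∈ I, i)) {L M y : ℝ} (hM : 1 ≤ M) (hY : (Y : ℝ) ≤ y * M)
    (hL : ((largeSquarePrimes n N a b T Y).card : ℝ) ≤ L) (hT : (M - 1) / 2 ≤ T)
    (hlarge : (2 ^ Q.card - 1) + 2 ^ Q.card * I.card + 2 * 2 ^ Q.card * (y * M / 3 + 1) + L <
      siftedDensity Q * ((M - 1) / 2) * (1 - 0.411 + ∑ q ∈ Q, 2 / (q : ℝ) ^ 2 -
        ∑ i ∈ I, (1 / (i : ℝ) - 2 / (i : ℝ) ^ 2))) : False := by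
  refine h.false_of_bounds Q I hQ hI hr (fun q hq => ?_) (hN.trans_lt hprod)
    (by linarith : 0 ≤ (M - 1) / 2) hL hT (lt_of_le_of_lt ?_ hlarge)
  · have h1 := (mem_oddSquarePrimes h.pos).1 hq
    rcases lt_or_ge q r with h2 | h2
    · rcases hQI q h2 h1.1 h1.2.1 (hP q hq) with h3 | h3 <;> tauto
    · tauto
  · gcongr

lemma SieveData.le_mul {n N a b T Y : ℕ} (h : SieveData n N a b T Y) {l y M : ℝ} (hl : l ≤ N)
    (hy : 0 ≤ y) (hyl : 2 ≤ y ^ 2 * l) (hM : N ≤ M) : (Y : ℝ) ≤ y * M := by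
  have h1 : (Y : ℝ) ^ 2 ≤ 2 * N := by exact_mod_cast h.sq_le
  have hN : (0 : ℝ) ≤ N := Nat.cast_nonneg N
  have h2 : (Y : ℝ) ^ 2 ≤ (y * N) ^ 2 := by
    have h3 : y ^ 2 * l ≤ y ^ 2 * N := by gcongr
    have h4 : 2 * (N : ℝ) ≤ y ^ 2 * N * N := by gcongr; linarith
    linarith
  have h5 : (Y : ℝ) ≤ y * N := (pow_le_pow_iff_left₀ (Nat.cast_nonneg Y) (by positivity)
    two_ne_zero).1 h2
  exact h5.trans (by gcongr)

set_option synthInstance.maxSize 1000 in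
lemma SieveData.false_of_ge_two_pow_12 {n N a b T Y : ℕ} (h : SieveData n N a b T Y) (hlo : 4096 ≤ N)
    (hhi : N ≤ 8192) {M : ℝ} (hNM : N ≤ M) (hT : (M - 1) / 2 ≤ T)
    (hL : ∀ k C : ℕ, dyadicPrimeCount k ≤ C →
      k * ((largeSquarePrimes n N a b T Y).card : ℝ) ≤ 1.1548 * M + C) : False := by
  have hlo' : (4096 : ℝ) ≤ N := by exact_mod_cast hlo
  have hM1 : (1 : ℝ) ≤ M := by linarith
  have hY := h.le_mul (y := 0.0221) hlo' (by norm_num) (by norm_num) hNM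
  have hL' : ((largeSquarePrimes n N a b T Y).card : ℝ) ≤ (1.1548 * M + 1268) / 12 := by
    have := hL 12 _ dyadicPrimeCount_twelve
    push_cast at this
    linarith
  by_cases h3 : 3 ∈ oddSquarePrimes n
  · exact h.false_of_le (fun q => True) (fun _ _ => trivial) {3} {5, 7, 11} 13 (by simpa using h3)
        (by decide) (by decide) (by decide +kernel) (H := 8192) (by omega) (by decide) hM1 hY
        hL' hT (by norm_num [siftedDensity]; linarith)
  by_cases h5 : 5 ∈ oddSquarePrimes n
  · exact h.false_of_le (fun q => q ≠ 3) (fun q hq h' => h3 (h' ▸ hq)) {5} {7, 11, 13} 17 (by simpa using h5)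
        (by decide) (by decide) (by decide +kernel) (H := 8192) (by omega) (by decide) hM1 hY
        hL' hT (by norm_num [siftedDensity]; linarith)
  · exact h.false_of_le (fun q => q ≠ 3 ∧ q ≠ 5) 
        (fun q hq => ⟨fun h' => h3 (h' ▸ hq), fun h' => h5 (h' ▸ hq)⟩) ∅ {7, 11, 13} 17 (by simp)
        (by decide) (by decide) (by decide +kernel) (H := 8192) (by omega) (by decide) hM1 hY
        hL' hT (by norm_num [siftedDensity]; linarith)

set_option synthInstance.maxSize 1000 in
lemma SieveData.false_of_ge_two_pow_13 {n N a b T Y : ℕ} (h : SieveData n N a b T Y) (hlo : 8192 ≤ N)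
    (hhi : N ≤ 131072) {M : ℝ} (hNM : N ≤ M) (hT : (M - 1) / 2 ≤ T)
    (hL : ∀ k C : ℕ, dyadicPrimeCount k ≤ C →
      k * ((largeSquarePrimes n N a b T Y).card : ℝ) ≤ 1.1548 * M + C) : False := by
  have hlo' : (8192 : ℝ) ≤ N := by exact_mod_cast hlo
  have hM1 : (1 : ℝ) ≤ M := by linarith
  have hY := h.le_mul (y := 0.015625) hlo' (by norm_num) (by norm_num) hNM
  have hL' : ((largeSquarePrimes n N a b T Y).card : ℝ) ≤ (1.1548 * M + 2296) / 13 := by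
    have := hL 13 _ dyadicPrimeCount_thirteen
    push_cast at this
    linarith
  by_cases h3 : 3 ∈ oddSquarePrimes n
  · exact h.false_of_le (fun q => True) (fun _ _ => trivial) {3} {5, 7, 11, 13} 17 (by simpa using h3)
        (by decide) (by decide) (by decide +kernel) (H := 131072) (by omega) (by decide) hM1 hY
        hL' hT (by norm_num [siftedDensity]; linarith)
  by_cases h5 : 5 ∈ oddSquarePrimes n
  · exact h.false_of_le (fun q => q ≠ 3) (fun q hq h' => h3 (h' ▸ hq)) {5} {7, 11, 13, 17} 19 (by simpa using h5)
        (by decide) (by decide) (by decide +kernel) (H := 131072) (by omega) (by decide) hM1 hY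
        hL' hT (by norm_num [siftedDensity]; linarith)
  · exact h.false_of_le (fun q => q ≠ 3 ∧ q ≠ 5) 
        (fun q hq => ⟨fun h' => h3 (h' ▸ hq), fun h' => h5 (h' ▸ hq)⟩) ∅ {7, 11, 13, 17} 19 (by simp)
        (by decide) (by decide) (by decide +kernel) (H := 131072) (by omega) (by decide) hM1 hY
        hL' hT (by norm_num [siftedDensity]; linarith)

set_option synthInstance.maxSize 1000 in
lemma SieveData.false_of_ge_two_pow_17 {n N a b T Y : ℕ} (h : SieveData n N a b T Y) (hlo : 131072 ≤ N)
    (hhi : N ≤ 8388608) {M : ℝ} (hNM : N ≤ M) (hT : (M - 1) / 2 ≤ T)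
    (hL : ∀ k C : ℕ, dyadicPrimeCount k ≤ C →
      k * ((largeSquarePrimes n N a b T Y).card : ℝ) ≤ 1.1548 * M + C) : False := by
  have hlo' : (131072 : ℝ) ≤ N := by exact_mod_cast hlo
  have hM1 : (1 : ℝ) ≤ M := by linarith
  have hY := h.le_mul (y := 0.00390625) hlo' (by norm_num) (by norm_num) hNM
  have hL' : ((largeSquarePrimes n N a b T Y).card : ℝ) ≤ (1.1548 * M + 20472) / 16 := by
    have := hL 16 _ dyadicPrimeCount_sixteen
    push_cast at this
    linarith
  by_cases h3 : 3 ∈ oddSquarePrimes n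
  · exact h.false_of_le (fun q => True) (fun _ _ => trivial) {3} {5, 7, 11, 13, 17, 19} 23 (by simpa using h3)
        (by decide) (by decide) (by decide +kernel) (H := 8388608) (by omega) (by decide) hM1 hY
        hL' hT (by norm_num [siftedDensity]; linarith)
  by_cases h5 : 5 ∈ oddSquarePrimes n
  · exact h.false_of_le (fun q => q ≠ 3) (fun q hq h' => h3 (h' ▸ hq)) {5} {7, 11, 13, 17, 19} 23 (by simpa using h5)
        (by decide) (by decide) (by decide +kernel) (H := 8388608) (by omega) (by decide) hM1 hY
        hL' hT (by norm_num [siftedDensity]; linarith)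
  · exact h.false_of_le (fun q => q ≠ 3 ∧ q ≠ 5) 
        (fun q hq => ⟨fun h' => h3 (h' ▸ hq), fun h' => h5 (h' ▸ hq)⟩) ∅ {7, 11, 13, 17, 19, 23} 29 (by simp)
        (by decide) (by decide) (by decide +kernel) (H := 8388608) (by omega) (by decide) hM1 hY
        hL' hT (by norm_num [siftedDensity]; linarith)

set_option synthInstance.maxSize 1000 in
lemma SieveData.false_of_ge_two_pow_23 {n N a b T Y : ℕ} (h : SieveData n N a b T Y) (hlo : 8388608 ≤ N)
    (hhi : N ≤ 1073741824) {M : ℝ} (hNM : N ≤ M) (hT : (M - 1) / 2 ≤ T)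
    (hL : ∀ k C : ℕ, dyadicPrimeCount k ≤ C →
      k * ((largeSquarePrimes n N a b T Y).card : ℝ) ≤ 1.1548 * M + C) : False := by
  have hlo' : (8388608 : ℝ) ≤ N := by exact_mod_cast hlo
  have hM1 : (1 : ℝ) ≤ M := by linarith
  have hY := h.le_mul (y := 0.00048829) hlo' (by norm_num) (by norm_num) hNM
  have hL' : ((largeSquarePrimes n N a b T Y).card : ℝ) ≤ (1.1548 * M + 4231200) / 24 := by
    have := hL 24 _ dyadicPrimeCount_twentyfour
    push_cast at this
    linarith
  by_cases h3 : 3 ∈ oddSquarePrimes n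
  · exact h.false_of_le (fun q => True) (fun _ _ => trivial) {3} {5, 7, 11, 13, 17, 19, 23} 29 (by simpa using h3)
        (by decide) (by decide) (by decide +kernel) (H := 1073741824) (by omega) (by decide) hM1 hY
        hL' hT (by norm_num [siftedDensity]; linarith)
  by_cases h5 : 5 ∈ oddSquarePrimes n
  · exact h.false_of_le (fun q => q ≠ 3) (fun q hq h' => h3 (h' ▸ hq)) {5} {7, 11, 13, 17, 19, 23, 29} 31 (by simpa using h5)
        (by decide) (by decide) (by decide +kernel) (H := 1073741824) (by omega) (by decide) hM1 hY
        hL' hT (by norm_num [siftedDensity]; linarith)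
  · exact h.false_of_le (fun q => q ≠ 3 ∧ q ≠ 5) 
        (fun q hq => ⟨fun h' => h3 (h' ▸ hq), fun h' => h5 (h' ▸ hq)⟩) ∅ {7, 11, 13, 17, 19, 23, 29} 31 (by simp)
        (by decide) (by decide) (by decide +kernel) (H := 1073741824) (by omega) (by decide) hM1 hY
        hL' hT (by norm_num [siftedDensity]; linarith)

lemma card_largeSquarePrimes_le (n N a b T Y : ℕ) :
    (largeSquarePrimes n N a b T Y).card ≤ primeCount (N + 1) := by
  rw [primeCount_eq]
  refine Finset.card_le_card fun p hp => ?_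
  simp only [largeSquarePrimes, Finset.mem_filter, Finset.mem_range] at hp
  exact Nat.mem_primesBelow.2 ⟨hp.1, hp.2.1⟩

set_option synthInstance.maxSize 1000 in
lemma SieveData.false_of_mod_four_of_ge_two_pow_12 {n N a b T Y : ℕ} (h : SieveData n N a b T Y) (hlo : 4096 ≤ N)
    (hhi : N ≤ 8191) (hT : ((N : ℝ) - 1) / 2 ≤ T)
    (hmod : ∀ q ∈ oddSquarePrimes n, q % 4 = 1) : False := by
  have hlo' : (4096 : ℝ) ≤ N := by exact_mod_cast hlo
  have hM1 : (1 : ℝ) ≤ N := by linarith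
  have hY := h.le_mul (y := 0.0221) hlo' (by norm_num) (by norm_num) le_rfl
  have hL' : ((largeSquarePrimes n N a b T Y).card : ℝ) ≤ 0.168 * N := by
    have h1 := card_largeSquarePrimes_le n N a b T Y
    have h2 := primeCount_le_of_lt hlo (by omega)
    have h3 : 1000 * ((largeSquarePrimes n N a b T Y).card : ℝ) ≤ 168 * N := by
      exact_mod_cast (Nat.mul_le_mul_left 1000 h1).trans h2
    linarith
  by_cases h5 : 5 ∈ oddSquarePrimes n
  · exact h.false_of_le (fun q => q % 4 = 1) hmod {5} {13, 17} 29 (by simpa using h5)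
        (by decide) (by decide) (by decide +kernel) (H := 8192) (by omega) (by decide) hM1 hY
        hL' hT (by norm_num [siftedDensity]; linarith)
  · exact h.false_of_le (fun q => q % 4 = 1 ∧ q ≠ 5) 
        (fun q hq => ⟨hmod q hq, fun h' => h5 (h' ▸ hq)⟩) ∅ {13, 17, 29} 37 (by simp)
        (by decide) (by decide) (by decide +kernel) (H := 8192) (by omega) (by decide) hM1 hY
        hL' hT (by norm_num [siftedDensity]; linarith)

set_option synthInstance.maxSize 1000 in
lemma SieveData.false_of_mod_four_of_ge_two_pow_13 {n N a b T Y : ℕ} (h : SieveData n N a b T Y) (hlo : 8192 ≤ N)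
    (hhi : N ≤ 131072) (hT : ((N : ℝ) - 1) / 2 ≤ T)
    (hmod : ∀ q ∈ oddSquarePrimes n, q % 4 = 1) : False := by
  have hlo' : (8192 : ℝ) ≤ N := by exact_mod_cast hlo
  have hM1 : (1 : ℝ) ≤ N := by linarith
  have hY := h.le_mul (y := 0.015625) hlo' (by norm_num) (by norm_num) le_rfl
  have hL' : ((largeSquarePrimes n N a b T Y).card : ℝ) ≤ (2 * N + 2296) / 13 := by
    have h1 := card_largeSquarePrimes_le n N a b T Y
    have h2 := (mul_primeCount_le 13 N).trans (Nat.add_le_add_left dyadicPrimeCount_thirteen _)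
    have h3 : 13 * ((largeSquarePrimes n N a b T Y).card : ℝ) ≤ ((2 * N + 2296 : ℕ) : ℝ) := by
      exact_mod_cast (Nat.mul_le_mul_left 13 h1).trans h2
    push_cast at h3
    linarith
  by_cases h5 : 5 ∈ oddSquarePrimes n
  · exact h.false_of_le (fun q => q % 4 = 1) hmod {5} {13, 17, 29} 37 (by simpa using h5)
        (by decide) (by decide) (by decide +kernel) (H := 131072) (by omega) (by decide) hM1 hY
        hL' hT (by norm_num [siftedDensity]; linarith)
  · exact h.false_of_le (fun q => q % 4 = 1 ∧ q ≠ 5) 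
        (fun q hq => ⟨hmod q hq, fun h' => h5 (h' ▸ hq)⟩) ∅ {13, 17, 29} 37 (by simp)
        (by decide) (by decide) (by decide +kernel) (H := 131072) (by omega) (by decide) hM1 hY
        hL' hT (by norm_num [siftedDensity]; linarith)

set_option synthInstance.maxSize 1000 in
lemma SieveData.false_of_mod_four_of_ge_two_pow_17 {n N a b T Y : ℕ} (h : SieveData n N a b T Y) (hlo : 131072 ≤ N)
    (hhi : N ≤ 8388608) (hT : ((N : ℝ) - 1) / 2 ≤ T)
    (hmod : ∀ q ∈ oddSquarePrimes n, q % 4 = 1) : False := by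
  have hlo' : (131072 : ℝ) ≤ N := by exact_mod_cast hlo
  have hM1 : (1 : ℝ) ≤ N := by linarith
  have hY := h.le_mul (y := 0.00390625) hlo' (by norm_num) (by norm_num) le_rfl
  have hL' : ((largeSquarePrimes n N a b T Y).card : ℝ) ≤ (2 * N + 20472) / 16 := by
    have h1 := card_largeSquarePrimes_le n N a b T Y
    have h2 := (mul_primeCount_le 16 N).trans (Nat.add_le_add_left dyadicPrimeCount_sixteen _)
    have h3 : 16 * ((largeSquarePrimes n N a b T Y).card : ℝ) ≤ ((2 * N + 20472 : ℕ) : ℝ) := by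
      exact_mod_cast (Nat.mul_le_mul_left 16 h1).trans h2
    push_cast at h3
    linarith
  by_cases h5 : 5 ∈ oddSquarePrimes n
  · exact h.false_of_le (fun q => q % 4 = 1) hmod {5} {13, 17, 29, 37} 41 (by simpa using h5)
        (by decide) (by decide) (by decide +kernel) (H := 8388608) (by omega) (by decide) hM1 hY
        hL' hT (by norm_num [siftedDensity]; linarith)
  · exact h.false_of_le (fun q => q % 4 = 1 ∧ q ≠ 5) 
        (fun q hq => ⟨hmod q hq, fun h' => h5 (h' ▸ hq)⟩) ∅ {13, 17, 29, 37} 41 (by simp)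
        (by decide) (by decide) (by decide +kernel) (H := 8388608) (by omega) (by decide) hM1 hY
        hL' hT (by norm_num [siftedDensity]; linarith)

set_option synthInstance.maxSize 1000 in
lemma SieveData.false_of_mod_four_of_ge_two_pow_23 {n N a b T Y : ℕ} (h : SieveData n N a b T Y) (hlo : 8388608 ≤ N)
    (hhi : N ≤ 1073741824) (hT : ((N : ℝ) - 1) / 2 ≤ T)
    (hmod : ∀ q ∈ oddSquarePrimes n, q % 4 = 1) : False := by
  have hlo' : (8388608 : ℝ) ≤ N := by exact_mod_cast hlo
  have hM1 : (1 : ℝ) ≤ N := by linarith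
  have hY := h.le_mul (y := 0.00048829) hlo' (by norm_num) (by norm_num) le_rfl
  have hL' : ((largeSquarePrimes n N a b T Y).card : ℝ) ≤ (2 * N + 4231200) / 24 := by
    have h1 := card_largeSquarePrimes_le n N a b T Y
    have h2 := (mul_primeCount_le 24 N).trans (Nat.add_le_add_left dyadicPrimeCount_twentyfour _)
    have h3 : 24 * ((largeSquarePrimes n N a b T Y).card : ℝ) ≤ ((2 * N + 4231200 : ℕ) : ℝ) := by
      exact_mod_cast (Nat.mul_le_mul_left 24 h1).trans h2
    push_cast at h3
    linarith
  by_cases h5 : 5 ∈ oddSquarePrimes n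
  · exact h.false_of_le (fun q => q % 4 = 1) hmod {5} {13, 17, 29, 37, 41} 53 (by simpa using h5)
        (by decide) (by decide) (by decide +kernel) (H := 1073741824) (by omega) (by decide) hM1 hY
        hL' hT (by norm_num [siftedDensity]; linarith)
  · exact h.false_of_le (fun q => q % 4 = 1 ∧ q ≠ 5) 
        (fun q hq => ⟨hmod q hq, fun h' => h5 (h' ▸ hq)⟩) ∅ {13, 17, 29, 37, 41, 53} 61 (by simp)
        (by decide) (by decide) (by decide +kernel) (H := 1073741824) (by omega) (by decide) hM1 hY
        hL' hT (by norm_num [siftedDensity]; linarith)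

lemma SieveData.false_of_dyadic {n N a b T Y : ℕ} (h : SieveData n N a b T Y) (hlo : 4096 ≤ N)
    (hhi : N ≤ 2 ^ 30) {M : ℝ} (hNM : N ≤ M) (hT : (M - 1) / 2 ≤ T)
    (hL : ∀ k C : ℕ, dyadicPrimeCount k ≤ C →
      k * ((largeSquarePrimes n N a b T Y).card : ℝ) ≤ 1.1548 * M + C) : False := by
  rcases le_total N 8192 with h1 | h1
  · exact h.false_of_ge_two_pow_12 hlo h1 hNM hT hL
  rcases le_total N 131072 with h2 | h2
  · exact h.false_of_ge_two_pow_13 h1 h2 hNM hT hL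
  rcases le_total N 8388608 with h3 | h3
  · exact h.false_of_ge_two_pow_17 h2 h3 hNM hT hL
  · exact h.false_of_ge_two_pow_23 h3 (by omega) hNM hT hL

lemma SieveData.false_of_mod_four {n N a b T Y : ℕ} (h : SieveData n N a b T Y) (hlo : 4096 ≤ N)
    (hhi : N ≤ 2 ^ 30) (hT : ((N : ℝ) - 1) / 2 ≤ T)
    (hmod : ∀ q ∈ oddSquarePrimes n, q % 4 = 1) : False := by
  rcases lt_or_ge N 8192 with h1 | h1
  · exact h.false_of_mod_four_of_ge_two_pow_12 hlo (by omega) hT hmod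
  rcases le_total N 131072 with h2 | h2
  · exact h.false_of_mod_four_of_ge_two_pow_13 h1 h2 hT hmod
  rcases le_total N 8388608 with h3 | h3
  · exact h.false_of_mod_four_of_ge_two_pow_17 h2 h3 hT hmod
  · exact h.false_of_mod_four_of_ge_two_pow_23 h3 (by omega) hT hmod

lemma two_div_one_sub_inv_pow_four_le {q : ℕ} (hq : 23 ≤ q) :
    (2 / (1 - 1 / (q : ℝ))) ^ 4 ≤ q := by
  have hq' : (23 : ℝ) ≤ q := by exact_mod_cast hq
  have h1 : (22 : ℝ) / 23 ≤ 1 - 1 / q := by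
    have : 1 / (q : ℝ) ≤ 1 / 23 := one_div_le_one_div_of_le (by norm_num) hq'
    linarith
  have h2 : 2 / (1 - 1 / (q : ℝ)) ≤ 2 / (22 / 23) := by gcongr
  have h3 : 0 ≤ 2 / (1 - 1 / (q : ℝ)) := div_nonneg (by norm_num) (by linarith)
  calc (2 / (1 - 1 / (q : ℝ))) ^ 4 ≤ (2 / (22 / 23)) ^ 4 := by gcongr
    _ ≤ 23 := by norm_num
    _ ≤ q := hq'

lemma two_pow_card_div_siftedDensity_pow_four_le {Q : Finset ℕ}
    (hQ : ∀ q ∈ Q, q.Prime ∧ q ≠ 2) :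
    (2 ^ Q.card / siftedDensity Q) ^ 4 ≤ 4096 * ∏ q ∈ Q, (q : ℝ) := by
  set S : Finset ℕ := {3, 5, 7, 11, 13, 17, 19} with hS
  set g : ℕ → ℝ := fun q => (2 / (1 - 1 / (q : ℝ))) ^ 4 / q with hg
  have hg0 : ∀ q, 0 ≤ g q := fun q => by positivity
  have hg1 : ∀ q ∈ S, 1 ≤ g q := by
    intro q hq
    simp only [hS, Finset.mem_insert, Finset.mem_singleton] at hq
    rcases hq with rfl | rfl | rfl | rfl | rfl | rfl | rfl <;> norm_num [hg]
  have hg2 : ∀ q ∈ Q, q ∉ S → g q ≤ 1 := by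
    intro q hq hqS
    have h23 : 23 ≤ q := by
      by_contra! hlt
      have h1 := hQ q hq
      clear hq
      revert h1 hqS
      interval_cases q <;> decide
    rw [hg]
    exact div_le_one_of_le₀ (two_div_one_sub_inv_pow_four_le h23) (Nat.cast_nonneg q)
  have hprodS : ∏ q ∈ S, g q ≤ 4096 := by norm_num [hS, hg]
  have h1 : ∏ q ∈ Q, g q ≤ 4096 := by
    rw [← Finset.prod_inter_mul_prod_sdiff Q S g]
    rw [← Finset.prod_inter_mul_prod_sdiff S Q g, Finset.inter_comm S Q] at hprodS
    have h2 : ∏ q ∈ Q \ S, g q ≤ 1 := Finset.prod_le_one (fun q _ => hg0 q) fun q hq =>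
      hg2 q (Finset.mem_sdiff.1 hq).1 (Finset.mem_sdiff.1 hq).2
    have h3 : 1 ≤ ∏ q ∈ S \ Q, g q := by
      rw [← Finset.prod_const_one (s := S \ Q)]
      exact Finset.prod_le_prod (fun _ _ => zero_le_one) fun q hq =>
        hg1 q (Finset.mem_sdiff.1 hq).1
    have h4 : 0 ≤ ∏ q ∈ Q ∩ S, g q := Finset.prod_nonneg fun q _ => hg0 q
    nlinarith
  have hpos : ∀ q ∈ Q, (0 : ℝ) < q := fun q hq => by exact_mod_cast (hQ q hq).1.pos
  have e : (2 ^ Q.card / siftedDensity Q) ^ 4 = (∏ q ∈ Q, g q) * ∏ q ∈ Q, (q : ℝ) := by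
    rw [siftedDensity, ← Finset.prod_const, ← Finset.prod_div_distrib, ← Finset.prod_pow,
      ← Finset.prod_mul_distrib]
    refine Finset.prod_congr rfl fun q hq => ?_
    rw [hg]
    exact (div_mul_cancel₀ _ (hpos q hq).ne').symm
  rw [e]
  exact mul_le_mul_of_nonneg_right h1 (Finset.prod_nonneg fun q hq => (hpos q hq).le)

/-- Large square primes are odd and avoid all primes dividing `n` and all small primes. -/
lemma card_largeSquarePrimes_le_siftedDensity {n N a b T Y : ℕ} {Q : Finset ℕ}
    (hQ : ∀ q ∈ Q, q.Prime ∧ q ≠ 2 ∧ (q ∣ n ∨ q ≤ Y)) (hY : 2 ≤ Y) {B : ℝ} (hB0 : 0 ≤ B)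
    (hB : ∀ p ∈ largeSquarePrimes n N a b T Y, (p : ℝ) ≤ B) :
    ((largeSquarePrimes n N a b T Y).card : ℝ) ≤
      siftedDensity Q * ((B + 1) / 2) + (2 ^ Q.card - 1) := by
  have hQp : ∀ q ∈ Q, q.Prime := fun q hq => (hQ q hq).1
  set U := ⌊(B + 1) / 2⌋₊ with hU
  have hUB : (U : ℝ) ≤ (B + 1) / 2 := Nat.floor_le (by positivity)
  have hodd : ∀ p ∈ largeSquarePrimes n N a b T Y, 1 + 2 * (p / 2) = p := by
    intro p hp
    simp only [largeSquarePrimes, Finset.mem_filter] at hp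
    rcases hp.2.1.eq_two_or_odd with h | h <;> omega
  have h1 : (largeSquarePrimes n N a b T Y).card ≤ (siftedSet Q 1 2 U).card := by
    refine Finset.card_le_card_of_injOn (fun p => p / 2) ?_ ?_
    · intro p hp
      have hp2 := hodd p hp
      have hpB := hB p hp
      simp only [largeSquarePrimes, Finset.coe_filter, Set.mem_ofPred_eq] at hp
      simp only [siftedSet, Finset.coe_filter, Set.mem_ofPred_eq, Finset.mem_range, hp2]
      refine ⟨?_, fun q hq hqp => ?_⟩
      · refine Nat.lt_of_succ_le (Nat.le_floor ?_)
        rw [← hp2] at hpB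
        push_cast at hpB ⊢
        linarith
      · have := (Nat.prime_dvd_prime_iff_eq (hQ q hq).1 hp.2.1).1 hqp
        subst this
        rcases (hQ q hq).2.2 with h | h
        · exact hp.2.2.2.1 h
        · omega
    · intro p hp q hq hpq
      rw [← hodd p hp, ← hodd q hq]
      simp only at hpq
      rw [hpq]
  have h2 := card_siftedSet_le hQp 1 2 U fun q hq =>
    (Nat.coprime_primes Nat.prime_two (hQ q hq).1).2 (Ne.symm (hQ q hq).2.1)
  have h3 : siftedDensity Q * U ≤ siftedDensity Q * ((B + 1) / 2) := by
    have := siftedDensity_pos hQp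
    gcongr
  have h4 : ((largeSquarePrimes n N a b T Y).card : ℝ) ≤ (siftedSet Q 1 2 U).card := by
    exact_mod_cast h1
  linarith

/-- The sieve inequality when all odd primes with square dividing `n` are sieved out. -/
lemma SieveData.full_sieve_inequality {n N a b T Y : ℕ} (h : SieveData n N a b T Y)
    (hN : 2 ^ 30 ≤ N) (W : Finset ℕ) (hW : ∀ w ∈ W, w.Prime ∧ w ≠ 2 ∧ w ≤ 23) (hWc : W.card ≤ 5)
    (hdisj : Disjoint (oddSquarePrimes n) W) {σ B S : ℝ}
    (hσ : ∑ p ∈ oddPrimesUpTo Y n, 2 / (p : ℝ) ^ 2 ≤ σ) (hσ1 : σ ≤ 1) (hB0 : 0 ≤ B)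
    (hB : ∀ p ∈ largeSquarePrimes n N a b T Y, (p : ℝ) ≤ B) (hS : S ≤ T) :
    S * (1 - σ) ≤ 0.042 * N + siftedDensity W * ((B + 1) / 2) := by
  have hn := h.pos
  set Q := oddSquarePrimes n with hQ
  have hQp : ∀ q ∈ Q, q.Prime ∧ q ≠ 2 ∧ q ^ 2 ∣ n := fun q hq => (mem_oddSquarePrimes hn).1 hq
  have hY : 46340 ≤ Y := by
    have := h.two_mul_lt
    by_contra! hlt
    nlinarith
  have hYr : (46340 : ℝ) ≤ Y := by exact_mod_cast hY
  have hρ : 0 < siftedDensity Q := siftedDensity_pos fun q hq => (hQp q hq).1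
  have hρW : 0 < siftedDensity W := siftedDensity_pos fun q hq => (hW q hq).1
  have hmain := h.sieve_inequality (Finset.Subset.refl _)
  rw [Finset.sdiff_self, Finset.sum_empty, zero_add] at hmain
  have hL := card_largeSquarePrimes_le_siftedDensity (Q := Q ∪ W) (Y := Y) (n := n) (fun q hq => by
    rcases Finset.mem_union.1 hq with hq | hq
    · have := hQp q hq
      exact ⟨this.1, this.2.1, Or.inl ((dvd_pow_self _ two_ne_zero).trans this.2.2)⟩
    · have := hW q hq
      exact ⟨this.1, this.2.1, Or.inr (by omega)⟩) (by omega) hB0 hB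
  have e1 : siftedDensity (Q ∪ W) = siftedDensity Q * siftedDensity W := by
    rw [siftedDensity, siftedDensity, siftedDensity, Finset.prod_union hdisj]
  rw [e1, Finset.card_union_of_disjoint hdisj, pow_add] at hL
  set R := siftedDensity Q with hR
  have e2 : ∑ p ∈ oddPrimesUpTo Y n, 2 * (R * T / (p : ℝ) ^ 2 + 2 ^ Q.card) =
      R * T * ∑ p ∈ oddPrimesUpTo Y n, 2 / (p : ℝ) ^ 2 +
        (oddPrimesUpTo Y n).card * (2 * 2 ^ Q.card) := by
    simp_rw [mul_add]
    rw [Finset.sum_add_distrib, Finset.mul_sum, Finset.sum_const, nsmul_eq_mul]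
    congr 1
    exact Finset.sum_congr rfl fun _ _ => by ring
  rw [← hQ, e2] at hmain
  have hP := card_oddPrimesUpTo_le Y n
  set K : ℝ := 2 ^ Q.card with hK
  have hK1 : (1 : ℝ) ≤ K := one_le_pow₀ (by norm_num)
  have hWK : (2 : ℝ) ^ W.card ≤ 32 := by
    calc (2 : ℝ) ^ W.card ≤ 2 ^ 5 := pow_le_pow_right₀ (by norm_num) hWc
      _ = 32 := by norm_num
  set E : ℝ := K / R with hE
  have hKE : K = R * E := by rw [hE]; field_simp
  have hE0 : 0 ≤ E := by positivity
  have hNr : (2 : ℝ) ^ 30 ≤ N := by exact_mod_cast hN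
  have hN0 : (0 : ℝ) ≤ N := Nat.cast_nonneg N
  have hE4 : E ^ 4 ≤ 4096 * N := by
    have h1 := two_pow_card_div_siftedDensity_pow_four_le fun q hq =>
      ⟨(hQp q hq).1, (hQp q hq).2.1⟩
    have h2 : ∏ q ∈ Q, (q : ℝ) ≤ N := by
      rw [hQ, ← Nat.cast_prod]
      exact Nat.cast_le.2 (prod_oddSquarePrimes_le hn h.le_sq)
    linarith
  have hEY : E * Y ≤ N / 16 := by
    have hY2 : (Y : ℝ) ^ 2 ≤ 2 * N := by exact_mod_cast h.sq_le
    refine (pow_le_pow_iff_left₀ (by positivity) (by positivity) four_ne_zero).1 ?_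
    have h1 : (Y : ℝ) ^ 4 ≤ (2 * (N : ℝ)) ^ 2 := by
      calc (Y : ℝ) ^ 4 = ((Y : ℝ) ^ 2) ^ 2 := by ring
        _ ≤ (2 * (N : ℝ)) ^ 2 := by gcongr
    calc (E * (Y : ℝ)) ^ 4 = E ^ 4 * (Y : ℝ) ^ 4 := by ring
      _ ≤ (4096 * (N : ℝ)) * (2 * (N : ℝ)) ^ 2 := by gcongr
      _ = 2 ^ 30 * (N : ℝ) ^ 3 / 65536 := by ring
      _ ≤ (N : ℝ) * (N : ℝ) ^ 3 / 65536 := by gcongr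
      _ = ((N : ℝ) / 16) ^ 4 := by ring
  have hf1 : R * T * ∑ p ∈ oddPrimesUpTo Y n, 2 / (p : ℝ) ^ 2 ≤ R * T * σ := by gcongr
  have hf2 : ((oddPrimesUpTo Y n).card : ℝ) * (2 * K) ≤ (Y / 3 + 1) * (2 * K) := by gcongr
  have hf3 : K * 2 ^ W.card ≤ K * 32 := by gcongr
  have hf4 : R * (T * (1 - σ)) ≤
      R * (E * (2 / 3 * Y + 35) + siftedDensity W * ((B + 1) / 2)) := by
    rw [hKE] at hmain hf2 hf3 hL hK1
    nlinarith
  have hf5 := le_of_mul_le_mul_left hf4 hρ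
  have hf6 : E * (2 / 3 * Y + 35) ≤ E * (0.668 * Y) := by
    gcongr
    linarith
  have hf7 : S * (1 - σ) ≤ T * (1 - σ) := by
    have : 0 ≤ 1 - σ := by linarith
    gcongr
  linarith

lemma sum_oddPrimesUpTo_le {n : ℕ} (hn : 0 < n) (Y : ℕ) {A : Finset ℕ}
    (hA : A ⊆ oddSquarePrimes n) :
    ∑ p ∈ oddPrimesUpTo Y n, 2 / (p : ℝ) ^ 2 ≤ 0.411 - ∑ p ∈ A, 2 / (p : ℝ) ^ 2 := by
  rw [le_sub_iff_add_le, ← Finset.sum_union]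
  · refine sum_two_div_sq_le fun p hp => ?_
    rcases Finset.mem_union.1 hp with hp | hp
    · simp only [oddPrimesUpTo, Finset.mem_filter] at hp
      tauto
    · have := (mem_oddSquarePrimes hn).1 (hA hp)
      tauto
  · rw [Finset.disjoint_left]
    intro p hp hp'
    simp only [oddPrimesUpTo, Finset.mem_filter] at hp
    exact hp.2.2.2 ((dvd_pow_self _ two_ne_zero).trans ((mem_oddSquarePrimes hn).1 (hA hp')).2.2)

lemma SieveData.false_of_largeSquarePrimes_le {n N a b T Y : ℕ} (h : SieveData n N a b T Y)
    (hlo : 4096 ≤ N) {M : ℝ} (hNM : N ≤ M) (hT : (M - 1) / 2 ≤ T)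
    (hL : ∀ p ∈ largeSquarePrimes n N a b T Y, (p : ℝ) ≤ 0.5774 * M) : False := by
  have hM : (4096 : ℝ) ≤ M := le_trans (by exact_mod_cast hlo) hNM
  rcases le_total N (2 ^ 30) with hN | hN
  · refine h.false_of_dyadic hlo hN hNM hT fun k C hC => ?_
    have h1 : (largeSquarePrimes n N a b T Y).card ≤ primeCount (⌊0.5774 * M⌋₊ + 1) := by
      rw [primeCount_eq]
      refine Finset.card_le_card fun p hp => ?_
      have h2 := Nat.le_floor (hL p hp)
      simp only [largeSquarePrimes, Finset.mem_filter] at hp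
      exact Nat.mem_primesBelow.2 ⟨by omega, hp.2.1⟩
    have h2 := (mul_primeCount_le k ⌊0.5774 * M⌋₊).trans (Nat.add_le_add_left hC _)
    have h3 : k * ((largeSquarePrimes n N a b T Y).card : ℝ) ≤
        ((2 * ⌊0.5774 * M⌋₊ + C : ℕ) : ℝ) := by
      exact_mod_cast (Nat.mul_le_mul_left k h1).trans h2
    have h4 : (⌊0.5774 * M⌋₊ : ℝ) ≤ 0.5774 * M := Nat.floor_le (by linarith)
    push_cast at h3
    linarith
  have hN' : (2 : ℝ) ^ 30 ≤ N := by exact_mod_cast hN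
  by_cases h3 : 3 ∈ oddSquarePrimes n
  · have h1 := sum_oddPrimesUpTo_le h.pos Y (Finset.singleton_subset_iff.2 h3)
    have h2 := h.full_sieve_inequality hN ∅ (by simp) (by simp) (by simp) h1 (by norm_num)
      (by linarith) hL hT
    norm_num [siftedDensity] at h2
    linarith
  · have h1 := sum_oddPrimesUpTo_le h.pos Y (Finset.empty_subset _)
    have h2 := h.full_sieve_inequality hN {3} (by norm_num) (by simp) (by simpa using h3) h1
      (by norm_num) (by linarith) hL hT
    norm_num [siftedDensity] at h2
    linarith

lemma SieveData.false_of_mod_four_eq_one {n N a b T Y : ℕ} (h : SieveData n N a b T Y)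
    (hlo : 4096 ≤ N) (hT : ((N : ℝ) - 1) / 2 ≤ T)
    (hmod : ∀ q ∈ oddSquarePrimes n, q % 4 = 1) : False := by
  rcases le_total N (2 ^ 30) with hN | hN
  · exact h.false_of_mod_four hlo hN hT hmod
  have hN' : (2 : ℝ) ^ 30 ≤ N := by exact_mod_cast hN
  have h1 := sum_oddPrimesUpTo_le h.pos Y (Finset.empty_subset _)
  have h2 := h.full_sieve_inequality (B := N) hN {3, 7, 11, 19, 23} (by norm_num) (by decide)
    (Finset.disjoint_right.2 fun q hq hq' => by
      have := hmod q hq'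
      simp only [Finset.mem_insert, Finset.mem_singleton] at hq
      omega) h1 (by norm_num) (by linarith)
    (fun p hp => by
      simp only [largeSquarePrimes, Finset.mem_filter, Finset.mem_range] at hp
      exact_mod_cast Nat.lt_succ_iff.1 hp.1) hT
  norm_num [siftedDensity] at h2
  linarith

/-- Application of `f` to `m`, in a form that makes the kernel evaluate `m` first. -/
def evalWith (m : ℕ) (f : ℕ → ℕ) : ℕ :=
  match m with
  | 0 => f 0
  | k + 1 => f (k + 1)

lemma evalWith_eq (m : ℕ) (f : ℕ → ℕ) : evalWith m f = f m := by
  cases m <;> rfl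

/-- A bit mask with the bits at `s * j`, `j < 2 ^ r`, set. -/
def multiplesMask (s : ℕ) : ℕ → ℕ
  | 0 => 1
  | r + 1 => evalWith (multiplesMask s r) fun m => m ||| m <<< (s * 2 ^ r)

lemma testBit_multiplesMask (s r : ℕ) : ∀ j < 2 ^ r, (multiplesMask s r).testBit (s * j) = true := by
  induction r with
  | zero =>
    intro j hj
    obtain rfl : j = 0 := by simpa using hj
    simp [multiplesMask]
  | succ r ih =>
    intro j hj
    rw [multiplesMask, evalWith_eq, Nat.testBit_or, Nat.testBit_shiftLeft, Bool.or_eq_true]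
    rcases lt_or_ge j (2 ^ r) with h | h
    · exact Or.inl (ih j h)
    · right
      obtain ⟨i, rfl⟩ := Nat.exists_eq_add_of_le h
      rw [mul_add, Nat.add_sub_cancel_left, ih i (by rw [pow_succ] at hj; omega)]
      simp

/-- A bit mask whose bit `i < len` is set if `s` divides `A + i`. -/
def windowMask (A len s : ℕ) : ℕ :=
  evalWith ((s - A % s) % s) fun o =>
    bif Nat.blt o len then multiplesMask s (Nat.log2 (2 * (len / s))) <<< o else 0

lemma testBit_windowMask {A len s i : ℕ} (hs : 0 < s) (hi : i < len) (h : s ∣ A + i) :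
    (windowMask A len s).testBit i = true := by
  rw [windowMask, evalWith_eq]
  set o := (s - A % s) % s with ho
  have h1 : s ∣ A + o := by
    rw [← Nat.modEq_zero_iff_dvd]
    calc A + o ≡ A % s + (s - A % s) [MOD s] := (Nat.mod_modEq A s).symm.add (Nat.mod_modEq _ s)
      _ = s := Nat.add_sub_cancel' (Nat.mod_lt A hs).le
      _ ≡ 0 [MOD s] := Nat.modEq_zero_iff_dvd.2 dvd_rfl
  have h2 : o < s := Nat.mod_lt _ hs
  have h3 : i % s = o := by
    have h4 : A + i ≡ A + o [MOD s] :=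
      ((Nat.modEq_zero_iff_dvd).2 h).trans ((Nat.modEq_zero_iff_dvd).2 h1).symm
    have h5 := Nat.ModEq.add_left_cancel' A h4
    rw [Nat.ModEq, Nat.mod_eq_of_lt h2] at h5
    exact h5
  have h4 : i = o + s * (i / s) := by rw [← h3, Nat.mod_add_div]
  have h5 : o ≤ i := by omega
  have h6 : i / s < 2 ^ Nat.log2 (2 * (len / s)) := by
    have h7 : i / s ≤ len / s := Nat.div_le_div_right hi.le
    have h8 : 2 * (len / s) < 2 ^ (Nat.log2 (2 * (len / s)) + 1) := Nat.lt_log2_self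
    rw [pow_succ] at h8
    omega
  rw [(by simp; omega : Nat.blt o len = true), cond_true, Nat.testBit_shiftLeft,
    (by omega : i - o = s * (i / s)), testBit_multiplesMask _ _ _ h6]
  simpa using h5

/-- A bit mask whose bit `i < len` is set if `A + i` is divisible by the square of a prime in
`[d, d + 2 ^ k)`. -/
def nonsquarefreeMask (A len : ℕ) : ℕ → ℕ → ℕ
  | 0, d => bif Nat.blt d 100 || Nat.beq (Nat.gcd d smallPrimorial) 1
      then windowMask A len (d ^ 2) else 0
  | k + 1, d => nonsquarefreeMask A len k d ||| nonsquarefreeMask A len k (d + 2 ^ k)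

lemma testBit_nonsquarefreeMask {A len i p : ℕ} (hi : i < len) (hp : p.Prime)
    (h : p ^ 2 ∣ A + i) (k : ℕ) : ∀ d, d ≤ p → p < d + 2 ^ k →
      (nonsquarefreeMask A len k d).testBit i = true := by
  induction k with
  | zero =>
    intro d h1 h2
    obtain rfl : d = p := by omega
    rw [nonsquarefreeMask]
    have h3 : (Nat.blt d 100 || Nat.beq (Nat.gcd d smallPrimorial) 1) = true := by
      rcases lt_or_ge d 100 with h3 | h3
      · simp [h3]
      · simp [Nat.Coprime.gcd_eq_one (hp.coprime_smallPrimorial h3)]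
    rw [h3, cond_true]
    exact testBit_windowMask (pow_pos hp.pos 2) hi h
  | succ k ih =>
    intro d h1 h2
    rw [nonsquarefreeMask, Nat.testBit_or, Bool.or_eq_true]
    rcases lt_or_ge p (d + 2 ^ k) with h3 | h3
    · exact Or.inl (ih d h1 h3)
    · exact Or.inr (ih _ h3 (by rw [pow_succ] at h2; omega))

/-- The conjunction of the shifts of `m` by the squares up to `x ^ 2`. -/
def squareShiftMask (m : ℕ) : ℕ → ℕ
  | 0 => m
  | x + 1 => squareShiftMask m x &&& m <<< (x + 1) ^ 2

lemma exists_testBit_eq_false_of_squareShiftMask {m i : ℕ} (X : ℕ) (hX : X ^ 2 ≤ i)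
    (h : (squareShiftMask m X).testBit i = false) :
    ∃ x ≤ X, m.testBit (i - x ^ 2) = false := by
  induction X with
  | zero => exact ⟨0, le_rfl, by simpa [squareShiftMask] using h⟩
  | succ X ih =>
    rw [squareShiftMask, Nat.testBit_and, Bool.and_eq_false_iff] at h
    rcases h with h | h
    · obtain ⟨x, hx, h1⟩ := ih ((Nat.pow_le_pow_left X.le_succ 2).trans hX) h
      exact ⟨x, hx.trans X.le_succ, h1⟩
    · refine ⟨X + 1, le_rfl, ?_⟩
      rw [Nat.testBit_shiftLeft] at h
      simpa [hX] using h

/-- The integers in `[A + 512, A + 512 + 2 ^ 20)` that are not a square at most `17 ^ 2` plus a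
squarefree integer. -/
def exceptionMask (A : ℕ) : ℕ :=
  (evalWith (nonsquarefreeMask A (2 ^ 20 + 512) 12 2) fun m => squareShiftMask m 17) >>> 512 %
    2 ^ 2 ^ 20

lemma exists_squarefree_of_exceptionMask {A n : ℕ} (h : exceptionMask A = 0) (hn : A + 512 ≤ n)
    (hn' : n < A + 512 + 2 ^ 20) (hA : A + 2 ^ 20 ≤ 2 ^ 24) :
    ∃ x, x ^ 2 < n ∧ Squarefree (n - x ^ 2) := by
  obtain ⟨k, rfl⟩ := Nat.exists_eq_add_of_le hn
  have h1 := congrArg (fun m => m.testBit k) h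
  simp only [exceptionMask, evalWith_eq, Nat.testBit_mod_two_pow, Nat.testBit_shiftRight,
    Nat.zero_testBit, (by omega : k < 2 ^ 20), decide_true, Bool.true_and] at h1
  obtain ⟨x, hx, h2⟩ := exists_testBit_eq_false_of_squareShiftMask 17 (by omega) h1
  have hx2 : x ^ 2 ≤ 17 ^ 2 := Nat.pow_le_pow_left hx 2
  refine ⟨x, by omega, ?_⟩
  by_contra hsq
  rw [Nat.squarefree_iff_prime_squarefree] at hsq
  push Not at hsq
  obtain ⟨p, hp, hdvd⟩ := hsq
  rw [← pow_two] at hdvd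
  have h3 := testBit_nonsquarefreeMask (A := A) (len := 2 ^ 20 + 512) (i := 512 + k - x ^ 2)
    (by omega) hp (by convert hdvd using 1; omega) 12 2 hp.two_le (by
      have h4 := Nat.le_of_dvd (by omega) hdvd
      by_contra! h5
      have : (2 + 2 ^ 12) ^ 2 ≤ p ^ 2 := Nat.pow_le_pow_left h5 2
      omega)
  rw [h2] at h3
  exact absurd h3 (by decide)

lemma exceptionMask_eq_zero : ∀ c < 16, exceptionMask (c * 2 ^ 20) = 0 := by decide +kernel

lemma exists_squarefree_of_lt_512 :
    ∀ n < 512, 0 < n → ∃ x < 23, x ^ 2 < n ∧ Squarefree (n - x ^ 2) := by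
  decide +kernel

lemma exists_squarefree_of_lt {n : ℕ} (hn : 0 < n) (hlt : n < 2 ^ 24) :
    ∃ x, x ^ 2 < n ∧ Squarefree (n - x ^ 2) := by
  rcases lt_or_ge n 512 with h | h
  · obtain ⟨x, -, hx⟩ := exists_squarefree_of_lt_512 n h hn
    exact ⟨x, hx⟩
  · refine exists_squarefree_of_exceptionMask
      (exceptionMask_eq_zero ((n - 512) / 2 ^ 20) (by omega)) ?_ ?_ ?_ <;> omega

lemma exists_odd_prime_sq_dvd {m : ℕ} (h : ¬ Squarefree m) (h4 : ¬ 4 ∣ m) :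
    ∃ p : ℕ, p.Prime ∧ p ≠ 2 ∧ p ^ 2 ∣ m := by
  rw [Nat.squarefree_iff_prime_squarefree] at h
  push Not at h
  obtain ⟨p, hp, hdvd⟩ := h
  refine ⟨p, hp, ?_, by rwa [pow_two]⟩
  rintro rfl
  exact h4 hdvd

lemma sq_mod_four (x : ℕ) : x ^ 2 % 4 = x % 2 := by
  rcases Nat.mod_two_eq_zero_or_one x with h | h
  · obtain ⟨k, rfl⟩ := Nat.dvd_of_mod_eq_zero h
    rw [(by ring : (2 * k) ^ 2 = 4 * k ^ 2)]
    omega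
  · obtain ⟨k, rfl⟩ : ∃ k, x = 2 * k + 1 := ⟨x / 2, by omega⟩
    rw [(by ring : (2 * k + 1) ^ 2 = 4 * (k ^ 2 + k) + 1)]
    omega

lemma sieveData_of_forall_not_squarefree {n N a b T : ℕ} (hn : 0 < n) (hN : 2 ≤ N)
    (hnN : n ≤ N ^ 2) (hNn : (N - 1) ^ 2 < n) (hb : b = 1 ∨ b = 2)
    (hlt : ∀ t < T, a + b * t ≤ N - 1) (h4 : ∀ t < T, (a + b * t) % 2 ≠ n % 4)
    (hbad : ∀ x, x ^ 2 < n → ¬ Squarefree (n - x ^ 2)) :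
    SieveData n N a b T (Nat.sqrt (2 * N)) := by
  have hsq : ∀ t < T, (a + b * t) ^ 2 < n := fun t ht =>
    (Nat.pow_le_pow_left (hlt t ht) 2).trans_lt hNn
  refine ⟨hn, hnN, hb, hsq, fun t ht => ?_, fun t ht => ?_, Nat.lt_succ_sqrt' _,
    Nat.sqrt_le' _, ?_⟩
  · have := hlt t ht
    omega
  · refine exists_odd_prime_sq_dvd (hbad _ (hsq t ht)) fun h => h4 t ht ?_
    have h1 := hsq t ht
    rw [← sq_mod_four]
    omega
  · exact Nat.le_sqrt'.2 (by omega)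

lemma cast_le_mul_of_three_mul_sq_le {p N : ℕ} (h : 3 * p ^ 2 ≤ N ^ 2) :
    (p : ℝ) ≤ 0.5774 * N := by
  have h' : 3 * (p : ℝ) ^ 2 ≤ N ^ 2 := by exact_mod_cast h
  have hN : (0 : ℝ) ≤ N := Nat.cast_nonneg N
  refine (pow_le_pow_iff_left₀ (Nat.cast_nonneg p) (by positivity) two_ne_zero).1 ?_
  nlinarith

lemma exists_eq_sq_add_of_mem_largeSquarePrimes {n N a T Y p : ℕ} (hY : 2 ≤ Y)
    (hlt : ∀ t < T, (a + 2 * t) ^ 2 < n) (hp : p ∈ largeSquarePrimes n N a 2 T Y) :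
    p.Prime ∧ ¬ p ∣ n ∧ ∃ x m, n = x ^ 2 + p ^ 2 * m ∧ 0 < m ∧ n % 4 = (a % 2 + m) % 4 := by
  simp only [largeSquarePrimes, Finset.mem_filter] at hp
  obtain ⟨-, hpp, hYp, hpn, t, ht, m, hm⟩ := hp
  have h1 := hlt t ht
  have h2 : n = (a + 2 * t) ^ 2 + p ^ 2 * m := by omega
  refine ⟨hpp, hpn, a + 2 * t, m, h2, Nat.pos_of_ne_zero ?_, ?_⟩
  · rintro rfl
    omega
  · have h3 : p ^ 2 % 4 = 1 := by
      rw [sq_mod_four]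
      exact hpp.eq_two_or_odd.resolve_left (by omega)
    have h4 := sq_mod_four (a + 2 * t)
    have h5 : p ^ 2 * m % 4 = m % 4 := by rw [Nat.mul_mod, h3, one_mul, Nat.mod_mod]
    omega

lemma three_mul_sq_le {n N x m p : ℕ} (hnN : n ≤ N ^ 2) (h : n = x ^ 2 + p ^ 2 * m)
    (hm : 3 ≤ m) : 3 * p ^ 2 ≤ N ^ 2 := by
  have := Nat.mul_le_mul_left (p ^ 2) hm
  have := Nat.zero_le (x ^ 2)
  omega

lemma dvd_of_dvd_sq_add_sq {q x y : ℕ} (hq : q.Prime) (hq4 : q % 4 = 3) (h : q ∣ x ^ 2 + y ^ 2) :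
    q ∣ y := by
  have := Fact.mk hq
  by_contra hy
  have h1 : (y : ZMod q) ≠ 0 := by rwa [Ne, ZMod.natCast_eq_zero_iff]
  have h2 : (x : ZMod q) ^ 2 + (y : ZMod q) ^ 2 = 0 := by
    exact_mod_cast (ZMod.natCast_eq_zero_iff _ _).2 h
  exact ZMod.mod_four_ne_three_of_sq_eq_neg_sq' h1 (eq_neg_of_add_eq_zero_left h2) hq4

lemma exists_squarefree_sub_sq_of_large {n N : ℕ} (hN : 4096 ≤ N) (hnN : n ≤ N ^ 2)
    (hNn : (N - 1) ^ 2 < n) : ∃ x, x ^ 2 < n ∧ Squarefree (n - x ^ 2) := by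
  by_contra! hbad
  have hn : 0 < n := by omega
  rcases (by omega : n % 4 = 0 ∨ n % 4 = 1 ∨ 2 ≤ n % 4) with h4 | h4 | h4
  · have h := sieveData_of_forall_not_squarefree (a := 1) (b := 2) (T := N / 2) hn (by omega)
      hnN hNn (Or.inr rfl) (fun t ht => by omega) (fun t ht => by omega) hbad
    have hT : (N : ℝ) ≤ 2 * (N / 2 : ℕ) + 1 := by exact_mod_cast (by omega : N ≤ 2 * (N / 2) + 1)
    refine h.false_of_largeSquarePrimes_le hN le_rfl (by linarith) fun p hp => ?_
    obtain ⟨-, -, x, m, hm, -, hm4⟩ := exists_eq_sq_add_of_mem_largeSquarePrimes h.two_le h.sq_lt hp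
    exact cast_le_mul_of_three_mul_sq_le (three_mul_sq_le hnN hm (by omega))
  · have h := sieveData_of_forall_not_squarefree (a := 0) (b := 2) (T := (N + 1) / 2) hn (by omega)
      hnN hNn (Or.inr rfl) (fun t ht => by omega) (fun t ht => by omega) hbad
    have hT : (N : ℝ) ≤ 2 * ((N + 1) / 2 : ℕ) + 1 := by
      exact_mod_cast (by omega : N ≤ 2 * ((N + 1) / 2) + 1)
    by_cases hmod : ∀ q ∈ oddSquarePrimes n, q % 4 = 1
    · exact h.false_of_mod_four_eq_one hN (by linarith) hmod
    push Not at hmod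
    obtain ⟨q, hq, hq4⟩ := hmod
    rw [mem_oddSquarePrimes hn] at hq
    have hq3 : q % 4 = 3 := by
      have := hq.1.eq_two_or_odd
      omega
    have hqn : q ∣ n := (dvd_pow_self _ two_ne_zero).trans hq.2.2
    refine h.false_of_largeSquarePrimes_le hN le_rfl (by linarith) fun p hp => ?_
    obtain ⟨hpp, hpn, x, m, hm, hm0, hm4⟩ :=
      exists_eq_sq_add_of_mem_largeSquarePrimes h.two_le h.sq_lt hp
    have hm1 : m ≠ 1 := by
      rintro rfl
      rw [mul_one] at hm
      have hqp := dvd_of_dvd_sq_add_sq hq.1 hq3 (hm ▸ hqn)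
      rw [Nat.prime_dvd_prime_iff_eq hq.1 hpp] at hqp
      exact hpn (hqp ▸ hqn)
    exact cast_le_mul_of_three_mul_sq_le (three_mul_sq_le hnN hm (by omega))
  · have h := sieveData_of_forall_not_squarefree (a := 0) (b := 1) (T := N) hn (by omega)
      hnN hNn (Or.inl rfl) (fun t ht => by omega) (fun t ht => by omega) hbad
    have hN0 : (0 : ℝ) ≤ N := Nat.cast_nonneg N
    refine h.false_of_largeSquarePrimes_le hN (M := 2 * N) (by linarith) (by linarith)
      fun p hp => ?_
    simp only [largeSquarePrimes, Finset.mem_filter, Finset.mem_range] at hp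
    have hpN : (p : ℝ) ≤ N := by exact_mod_cast Nat.lt_succ_iff.1 hp.1
    linarith

theorem square_plus_squarefree (n : ℕ) (hn : 0 < n) :
    ∃ x m : ℕ, 0 < m ∧ Squarefree m ∧ n = x ^ 2 + m := by
  obtain ⟨x, hx, hsq⟩ : ∃ x, x ^ 2 < n ∧ Squarefree (n - x ^ 2) := by
    rcases lt_or_ge n (2 ^ 24) with h | h
    · exact exists_squarefree_of_lt hn h
    · refine exists_squarefree_sub_sq_of_large (N := Nat.sqrt (n - 1) + 1) ?_ ?_ ?_
      · have : 4095 ≤ Nat.sqrt (n - 1) := Nat.le_sqrt'.2 (by omega)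
        omega
      · have := Nat.lt_succ_sqrt' (n - 1)
        rw [Nat.succ_eq_add_one] at this
        omega
      · have := Nat.sqrt_le' (n - 1)
        rw [Nat.add_sub_cancel]
        omega
  exact ⟨x, n - x ^ 2, by omega, hsq, by omega⟩
end

section
/- For every integer n ≥ 1 and every real δ with 0 < δ < 1, the number of divisors τ(n) satisfies τ(n) < exp(H(δ))·n^δ, where H(δ) = δ²·2^{1/δ}/(log 2)² + 7δ³·2^{1/δ}/(log 2)³. -/
open Finset

theorem primeCounting_succ_le (n : ℕ) : (n + 1).primeCounting ≤ n.primeCounting + 1 := by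
  simp only [Nat.primeCounting, Nat.primeCounting', Nat.count_succ _ (n + 1)]
  split_ifs <;> omega

theorem primeCounting_succ_of_not_prime {n : ℕ} (h : ¬ (n + 1).Prime) :
    (n + 1).primeCounting = n.primeCounting := by
  simp only [Nat.primeCounting, Nat.primeCounting', Nat.count_succ _ (n + 1), if_neg h, add_zero]

theorem primeCounting_six_mul_add_ten (q : ℕ) :
    (6 * q + 10).primeCounting = (6 * q + 7).primeCounting := by
  have h8 : ¬ (6 * q + 8).Prime := fun h => by
    have := (Nat.prime_dvd_prime_iff_eq Nat.prime_two h).1 ⟨3 * q + 4, by ring⟩; omega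
  have h9 : ¬ (6 * q + 9).Prime := fun h => by
    have := (Nat.prime_dvd_prime_iff_eq Nat.prime_three h).1 ⟨2 * q + 3, by ring⟩; omega
  have h10 : ¬ (6 * q + 10).Prime := fun h => by
    have := (Nat.prime_dvd_prime_iff_eq Nat.prime_two h).1 ⟨3 * q + 5, by ring⟩; omega
  rw [primeCounting_succ_of_not_prime h10, primeCounting_succ_of_not_prime h9,
    primeCounting_succ_of_not_prime h8]

theorem primeCounting_six_mul_add_twelve_le (q : ℕ) :
    (6 * q + 12).primeCounting ≤ (6 * q + 7).primeCounting + 1 := by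
  have h12 : ¬ (6 * q + 12).Prime := fun h => by
    have := (Nat.prime_dvd_prime_iff_eq Nat.prime_two h).1 ⟨3 * q + 6, by ring⟩; omega
  rw [primeCounting_succ_of_not_prime h12, ← primeCounting_six_mul_add_ten]
  exact primeCounting_succ_le _

theorem three_mul_primeCounting_le (n : ℕ) : 3 * n.primeCounting ≤ n + 5 := by
  have key : ∀ q : ℕ, (6 * q + 7).primeCounting ≤ 2 * q + 4 := by
    intro q
    induction q with
    | zero => decide
    | succ q ih =>
      have h1 := primeCounting_six_mul_add_twelve_le q
      have h2 := primeCounting_succ_le (6 * q + 12)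
      rw [show 6 * (q + 1) + 7 = 6 * q + 12 + 1 by ring]
      omega
  rcases lt_or_ge n 7 with hn | hn
  · interval_cases n <;> decide
  obtain ⟨q, r, hr, rfl⟩ : ∃ q r, r < 6 ∧ n = 6 * q + 7 + r :=
    ⟨(n - 7) / 6, (n - 7) % 6, Nat.mod_lt _ (by norm_num), by omega⟩
  have := key q
  rcases lt_or_ge r 4 with h | h
  · have h1 : (6 * q + 7 + r).primeCounting ≤ (6 * q + 10).primeCounting :=
      Nat.monotone_primeCounting (by omega)
    have h2 := primeCounting_six_mul_add_ten q
    omega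
  · have h1 : (6 * q + 7 + r).primeCounting ≤ (6 * q + 12).primeCounting :=
      Nat.monotone_primeCounting (by omega)
    have h2 := primeCounting_six_mul_add_twelve_le q
    omega

theorem primeCounting_le_div_three (n : ℕ) : (n.primeCounting : ℝ) ≤ n / 3 + 5 / 3 := by
  have : (3 : ℝ) * n.primeCounting ≤ n + 5 := by exact_mod_cast three_mul_primeCounting_le n
  linarith

/-- The sum of `log y - log p` over the primes `p ≤ n`. -/
noncomputable def primeLogDefect (n : ℕ) (y : ℝ) : ℝ :=
  ∑ p ∈ n.primesLE, (Real.log y - Real.log p)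

theorem primeLogDefect_eq (n : ℕ) (y : ℝ) :
    primeLogDefect n y = n.primeCounting * Real.log y - Chebyshev.theta n := by
  simp [primeLogDefect, Chebyshev.theta_eq_sum_primesLE_log, Nat.primesLE_card_eq_primeCounting]

theorem primeLogDefect_succ (n : ℕ) :
    primeLogDefect (n + 1) ((n + 1 : ℕ) : ℝ) = primeLogDefect n ((n + 1 : ℕ) : ℝ) := by
  unfold primeLogDefect
  rw [Nat.primesLE_succ]
  split_ifs
  · rw [sum_insert (Nat.notMem_primesLE n)]; simp
  · rfl

theorem primeLogDefect_nat_le (n : ℕ) (hn : 2 ≤ n) (y : ℝ) (hy : (n : ℝ) ≤ y) :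
    primeLogDefect n y ≤ y / 3 + 5 / 3 * Real.log y - 2 / 3 - 5 / 3 * Real.log 2 := by
  have hstep : ∀ (n : ℕ) (y : ℝ), 2 ≤ n → (n : ℝ) ≤ y →
      primeLogDefect n n ≤ n / 3 + 5 / 3 * Real.log n - 2 / 3 - 5 / 3 * Real.log 2 →
      primeLogDefect n y ≤ y / 3 + 5 / 3 * Real.log y - 2 / 3 - 5 / 3 * Real.log 2 := by
    intro n y hn hy h
    have hn0 : (0 : ℝ) < n := by positivity
    have hy0 : 0 < y := hn0.trans_le hy
    rw [primeLogDefect_eq] at h ⊢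
    have h1 : Real.log y - Real.log n ≤ y / n - 1 := by
      rw [← Real.log_div hy0.ne' hn0.ne']
      exact Real.log_le_sub_one_of_pos (by positivity)
    have h2 : n * (Real.log y - Real.log n) ≤ y - n := by
      calc _ ≤ n * (y / n - 1) := by gcongr
        _ = y - n := by field_simp
    have h3 : 0 ≤ Real.log y - Real.log n := sub_nonneg.2 (Real.log_le_log hn0 hy)
    have h4 := mul_le_mul_of_nonneg_right (primeCounting_le_div_three n) h3
    linarith
  refine hstep n y hn hy ?_
  clear hy y
  induction n, hn using Nat.le_induction with
  | base => simp [primeLogDefect, show Nat.primesLE 2 = {2} by decide]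
  | succ n hn ih =>
    rw [primeLogDefect_succ]
    exact hstep n _ hn (by simp) ih

theorem primeLogDefect_floor_le {y : ℝ} (hy : 2 ≤ y) :
    primeLogDefect ⌊y⌋₊ y ≤ y / 3 + 5 / 3 * Real.log y - 2 / 3 - 5 / 3 * Real.log 2 :=
  primeLogDefect_nat_le _ (Nat.le_floor hy) y (Nat.floor_le (by linarith))

theorem primeLogDefect_floor_le' {y : ℝ} (hy : 1 ≤ y) :
    primeLogDefect ⌊y⌋₊ y ≤ y / 3 + 5 / 3 * Real.log y := by
  rcases lt_or_ge y 2 with h | h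
  · have h1 : ⌊y⌋₊ = 1 := (Nat.floor_eq_iff (by linarith)).2 ⟨by simpa, by norm_num; linarith⟩
    have := Real.log_nonneg hy
    simp only [h1, primeLogDefect, Nat.primesLE_one, sum_empty]
    linarith
  · have := primeLogDefect_floor_le h
    have := Real.log_pos one_lt_two
    linarith

theorem inv_log_sub_inv_log_le {n y : ℝ} (hn : 512 ≤ n) (hy : n ≤ y) :
    n * (1 / Real.log n - 1 / Real.log y) ≤
      (y / Real.log y ^ 2 + 4 * y / Real.log y ^ 3) -
        (n / Real.log n ^ 2 + 4 * n / Real.log n ^ 3) := by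
  have hlog : ∀ t, n ≤ t → 6 < Real.log t := by
    intro t ht
    calc (6 : ℝ) < 9 * Real.log 2 := by linarith [Real.log_two_gt_d9]
      _ = Real.log (2 ^ 9) := by rw [Real.log_pow]; norm_num
      _ ≤ Real.log t := Real.log_le_log (by norm_num) (by norm_num; linarith)
  set F : ℝ → ℝ := fun t => t / Real.log t ^ 2 + 4 * t / Real.log t ^ 3 + n / Real.log t with hF
  have hder : ∀ t, n ≤ t → HasDerivAt F
      ((1 - n / t) / Real.log t ^ 2 + (2 * Real.log t - 12) / Real.log t ^ 4) t := by
    intro t ht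
    have h6 := hlog t ht
    have ht0 : t ≠ 0 := by linarith
    have hl0 : Real.log t ≠ 0 := by linarith
    have hl := Real.hasDerivAt_log ht0
    have h := (((hasDerivAt_id t).div (hl.pow 2) (pow_ne_zero 2 hl0)).add
      (((hasDerivAt_id t).const_mul 4).div (hl.pow 3) (pow_ne_zero 3 hl0))).add
      ((hasDerivAt_const t n).div hl hl0)
    refine h.congr_deriv ?_
    simp
    field_simp
    ring
  have hmono : MonotoneOn F (Set.Ici n) := by
    refine monotoneOn_of_deriv_nonneg (convex_Ici n)
      (fun t ht => (hder t ht).continuousAt.continuousWithinAt)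
      (fun t ht => ?_) (fun t ht => ?_)
    · rw [interior_Ici] at ht
      exact (hder t (le_of_lt ht)).differentiableAt.differentiableWithinAt
    · rw [interior_Ici] at ht
      have ht' : n ≤ t := le_of_lt ht
      rw [(hder t ht').deriv]
      have h6 := hlog t ht'
      have : n / t ≤ 1 := (div_le_one (by linarith)).2 ht'
      have : 0 ≤ 1 - n / t := by linarith
      have : 0 ≤ 2 * Real.log t - 12 := by linarith
      positivity
  have := hmono (Set.mem_Ici.2 le_rfl) (Set.mem_Ici.2 hy) hy
  simp only [hF] at this
  simp only [mul_sub, mul_one_div]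
  linarith

theorem primeLogDefect_nat_le_chebyshev (n : ℕ) (hn : 512 ≤ n) (y : ℝ) (hy : (n : ℝ) ≤ y) :
    primeLogDefect n y ≤ Real.log y * (Real.log 4 *
      (y / Real.log y ^ 2 + 4 * y / Real.log y ^ 3)) := by
  have hstep : ∀ (n : ℕ) (y : ℝ), 512 ≤ n → (n : ℝ) ≤ y →
      primeLogDefect n n ≤ Real.log n * (Real.log 4 *
        (n / Real.log n ^ 2 + 4 * n / Real.log n ^ 3)) →
      primeLogDefect n y ≤ Real.log y * (Real.log 4 *
        (y / Real.log y ^ 2 + 4 * y / Real.log y ^ 3)) := by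
    intro n y hn hy h
    have hn' : (512 : ℝ) ≤ n := by exact_mod_cast hn
    have hln : 0 < Real.log n := Real.log_pos (by linarith)
    have hlny : Real.log n ≤ Real.log y := Real.log_le_log (by linarith) hy
    have hly : 0 < Real.log y := hln.trans_le hlny
    have h1 := inv_log_sub_inv_log_le hn' hy
    have h2 : Chebyshev.theta n ≤ Real.log 4 * n := Chebyshev.theta_le_log4_mul_x (by positivity)
    have h3 : 0 ≤ 1 / Real.log n - 1 / Real.log y :=
      sub_nonneg.2 (one_div_le_one_div_of_le hln hlny)
    have h4 : 0 ≤ Real.log 4 := Real.log_nonneg (by norm_num)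
    have h5 := mul_le_mul_of_nonneg_right h2 h3
    have h6 := mul_le_mul_of_nonneg_left h1 h4
    have h7 : (n.primeCounting : ℝ) - Chebyshev.theta n * (1 / Real.log n) ≤
        Real.log 4 * (n / Real.log n ^ 2 + 4 * n / Real.log n ^ 3) := by
      refine le_of_mul_le_mul_left (le_trans (le_of_eq ?_) h) hln
      rw [primeLogDefect_eq]; field_simp
    have h8 : (n.primeCounting : ℝ) - Chebyshev.theta n * (1 / Real.log y) ≤
        Real.log 4 * (y / Real.log y ^ 2 + 4 * y / Real.log y ^ 3) := by
      linarith
    refine le_trans (le_of_eq ?_) (mul_le_mul_of_nonneg_left h8 hly.le)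
    rw [primeLogDefect_eq]; field_simp
  refine hstep n y hn hy ?_
  clear hy y
  induction n, hn using Nat.le_induction with
  | base =>
    have h := primeLogDefect_nat_le 512 (by norm_num) 512 (by norm_num)
    have h9 : Real.log 512 = 9 * Real.log 2 := by
      rw [show (512 : ℝ) = 2 ^ 9 by norm_num, Real.log_pow]; norm_num
    have h4 : Real.log 4 = 2 * Real.log 2 := by
      rw [show (4 : ℝ) = 2 ^ 2 by norm_num, Real.log_pow]; norm_num
    have l1 := Real.log_two_gt_d9
    have l2 := Real.log_two_lt_d9
    push_cast
    refine h.trans ?_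
    rw [h9, h4]
    have e : 9 * Real.log 2 * (2 * Real.log 2 *
        (512 / (9 * Real.log 2) ^ 2 + 4 * 512 / (9 * Real.log 2) ^ 3)) =
        1024 / 9 + 4096 / 81 / Real.log 2 := by field_simp; ring
    rw [e]
    have : 4096 / 81 / 0.6931471808 ≤ 4096 / 81 / Real.log 2 := by gcongr
    norm_num at this ⊢
    linarith
  | succ n hn ih =>
    rw [primeLogDefect_succ]
    exact hstep n _ hn (by simp) ih

theorem primeLogDefect_floor_le_chebyshev {y : ℝ} (hy : 512 ≤ y) :
    primeLogDefect ⌊y⌋₊ y ≤ Real.log y * (Real.log 4 *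
      (y / Real.log y ^ 2 + 4 * y / Real.log y ^ 3)) :=
  primeLogDefect_nat_le_chebyshev _ (Nat.le_floor hy) y (Nat.floor_le (by linarith))

theorem sub_one_sub_log_le_div {v : ℝ} (hv : 0 < v) (hv1 : v ≤ 1) :
    v - 1 - Real.log v ≤ 0.18 / v := by
  have tangent : ∀ a : ℝ, 0 < a → v ^ 2 - (2 + Real.log a) * v + a ≤ 0.18 →
      v - 1 - Real.log v ≤ 0.18 / v := by
    intro a ha h
    have h1 := Real.log_le_sub_one_of_pos (div_pos ha hv)
    rw [Real.log_div ha.ne' hv.ne'] at h1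
    rw [le_div_iff₀ hv]
    have h2 := mul_le_mul_of_nonneg_right h1 hv.le
    rw [sub_mul (a / v), div_mul_cancel₀ _ hv.ne'] at h2
    nlinarith
  have l1 := Real.log_two_gt_d9
  have l2 := Real.log_two_lt_d9
  have hlog : ∀ k : ℕ, Real.log ((1 / 2) ^ k) = -k * Real.log 2 := by
    intro k; rw [Real.log_pow, one_div, Real.log_inv]; ring
  have hmul : 0.693147 * v ≤ Real.log 2 * v ∧ Real.log 2 * v ≤ 0.693148 * v :=
    ⟨by gcongr; linarith, by gcongr; linarith⟩
  rcases le_or_gt v 0.18 with h | h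
  · refine tangent ((1 / 2) ^ 3) (by positivity) ?_
    rw [hlog]; push_cast; nlinarith
  rcases le_or_gt v 0.4 with h' | h'
  · refine tangent ((1 / 2) ^ 2) (by positivity) ?_
    rw [hlog]; push_cast; nlinarith
  rcases le_or_gt v 0.8 with h'' | h''
  · refine tangent ((1 / 2) ^ 1) (by positivity) ?_
    rw [hlog]; push_cast; nlinarith
  · refine tangent ((1 / 2) ^ 0) (by positivity) ?_
    rw [hlog]; push_cast; nlinarith

theorem log_succ_sub_mul_le (k : ℕ) {u : ℝ} (hu : 0 < u) :
    Real.log (k + 1) - k * u ≤ max 0 (Real.log 2 - u) + max 0 (Real.log (3 / 2) - u) +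
      if u ≤ Real.log (4 / 3) then 0.06 / u else 0 := by
  have hm1 := le_max_left 0 (Real.log 2 - u)
  have hm2 := le_max_right 0 (Real.log 2 - u)
  have hm3 := le_max_left 0 (Real.log (3 / 2) - u)
  have hm4 := le_max_right 0 (Real.log (3 / 2) - u)
  have h3 : Real.log 2 + Real.log (3 / 2) = Real.log 3 := by
    rw [← Real.log_mul (by norm_num) (by norm_num)]; norm_num
  have hite : 0 ≤ if u ≤ Real.log (4 / 3) then 0.06 / u else 0 := by
    split_ifs
    · positivity
    · exact le_rfl
  obtain rfl | rfl | rfl | hk : k = 0 ∨ k = 1 ∨ k = 2 ∨ 3 ≤ k := by omega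
  · simp only [Nat.cast_zero, zero_add, Real.log_one, zero_mul, sub_zero]; positivity
  · rw [show ((1 : ℕ) : ℝ) + 1 = 2 by norm_num]; push_cast; linarith
  · rw [show ((2 : ℕ) : ℝ) + 1 = 3 by norm_num]; push_cast; linarith
  suffices h : Real.log (k + 1) - Real.log 3 - (k - 2) * u ≤
      if u ≤ Real.log (4 / 3) then 0.06 / u else 0 by linarith
  have hk0 : (0 : ℝ) < k + 1 := by positivity
  split_ifs with hu'
  · have h1 := Real.log_le_sub_one_of_pos (mul_pos hk0 hu)
    rw [Real.log_mul hk0.ne' hu.ne'] at h1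
    have h43 : Real.log (4 / 3) ≤ 4 / 3 - 1 := Real.log_le_sub_one_of_pos (by norm_num)
    have h2 := sub_one_sub_log_le_div (v := 3 * u) (by positivity) (by linarith)
    rw [Real.log_mul (by norm_num) hu.ne'] at h2
    have h4 : 0.18 / (3 * u) = 0.06 / u := by field_simp; norm_num
    linarith
  · push Not at hu'
    obtain ⟨j, rfl⟩ : ∃ j, k = j + 2 := ⟨k - 2, by omega⟩
    have hj : (1 : ℝ) ≤ j := by exact_mod_cast (by omega : 1 ≤ j)
    have h1 : ((j + 2 : ℕ) + 1 : ℝ) / 3 ≤ (4 / 3) ^ j := by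
      have := one_add_mul_le_pow (show (-2 : ℝ) ≤ 1 / 3 by norm_num) j
      norm_num at this ⊢
      linarith
    have h2 := Real.log_le_log (by positivity) h1
    rw [Real.log_div hk0.ne' (by norm_num), Real.log_pow] at h2
    have h4 : j * Real.log (4 / 3) ≤ j * u := by gcongr
    push_cast at *
    linarith

theorem log_card_divisors {n : ℕ} (hn : n ≠ 0) :
    Real.log n.divisors.card = ∑ p ∈ n.primeFactors, Real.log (n.factorization p + 1) := by
  rw [Nat.card_divisors hn, Nat.cast_prod, Real.log_prod (fun p _ => by positivity)]
  simp

theorem log_eq_sum_factorization {n : ℕ} (hn : n ≠ 0) :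
    Real.log n = ∑ p ∈ n.primeFactors, n.factorization p * Real.log p := by
  conv_lhs => rw [← Nat.prod_factorization_pow_eq_self hn]
  rw [Nat.prod_factorization_eq_prod_primeFactors, Nat.cast_prod, Real.log_prod]
  · simp
  · intro p hp
    have := (Nat.prime_of_mem_primeFactors hp).pos
    positivity

theorem sum_max_log_sub_le_primeLogDefect (S : Finset ℕ) (hS : ∀ p ∈ S, p.Prime) {y : ℝ}
    (hy : 0 < y) :
    ∑ p ∈ S, max 0 (Real.log y - Real.log p) ≤ primeLogDefect ⌊y⌋₊ y := by
  have hnonneg : ∀ p ∈ (⌊y⌋₊).primesLE, 0 ≤ Real.log y - Real.log p := by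
    intro p hp
    rw [Nat.mem_primesLE] at hp
    exact sub_nonneg.2 (Real.log_le_log (by exact_mod_cast hp.2.pos)
      ((Nat.le_floor_iff hy.le).1 hp.1))
  calc ∑ p ∈ S, max 0 (Real.log y - Real.log p)
      ≤ ∑ p ∈ S ∪ (⌊y⌋₊).primesLE, max 0 (Real.log y - Real.log p) :=
        sum_le_sum_of_subset_of_nonneg subset_union_left fun _ _ _ => le_max_left _ _
    _ = ∑ p ∈ (⌊y⌋₊).primesLE, max 0 (Real.log y - Real.log p) := by
        refine (sum_subset subset_union_right fun p hp hp' => ?_).symm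
        have hpS : p.Prime := hS p ((mem_union.1 hp).resolve_right hp')
        have : y < p := by
          by_contra! h
          exact hp' (Nat.mem_primesLE.2 ⟨Nat.le_floor h, hpS⟩)
        exact max_eq_left (sub_nonpos.2 (Real.log_le_log hy this.le))
    _ = primeLogDefect ⌊y⌋₊ y :=
        sum_congr rfl fun p hp => max_eq_right (hnonneg p hp)

theorem sum_inv_log_le (S : Finset ℕ) (hS : ∀ p ∈ S, p.Prime) {y : ℝ} (hy : 0 ≤ y)
    (hSy : ∀ p ∈ S, (p : ℝ) ≤ y) :
    ∑ p ∈ S, 1 / Real.log p ≤ 1 / Real.log 2 + (y / 3 + 2 / 3) / Real.log 3 := by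
  have l2 : 0 < Real.log 2 := Real.log_pos one_lt_two
  have l3 : 0 < Real.log 3 := Real.log_pos (by norm_num)
  have l23 : 1 / Real.log 3 ≤ 1 / Real.log 2 :=
    one_div_le_one_div_of_le l2 (Real.log_le_log (by norm_num) (by norm_num))
  have hterm : ∀ p ∈ S, 1 / Real.log p ≤
      1 / Real.log 3 + if p = 2 then 1 / Real.log 2 - 1 / Real.log 3 else 0 := by
    intro p hp
    split_ifs with h
    · simp [h]
    · have h3 : 3 ≤ p := by have := (hS p hp).two_le; omega
      rw [add_zero]
      exact one_div_le_one_div_of_le l3 (Real.log_le_log (by norm_num) (by exact_mod_cast h3))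
  have hcard : (S.card : ℝ) ≤ y / 3 + 5 / 3 := by
    have h1 : S ⊆ (⌊y⌋₊).primesLE := fun p hp =>
      Nat.mem_primesLE.2 ⟨Nat.le_floor (hSy p hp), hS p hp⟩
    have h2 : (S.card : ℝ) ≤ (⌊y⌋₊).primeCounting := by
      rw [← Nat.primesLE_card_eq_primeCounting]; exact_mod_cast card_le_card h1
    have h3 := primeCounting_le_div_three ⌊y⌋₊
    have h4 := Nat.floor_le hy
    linarith
  refine (sum_le_sum hterm).trans ?_
  rw [sum_add_distrib, sum_const, nsmul_eq_mul, sum_ite_eq']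
  have h5 : (if 2 ∈ S then 1 / Real.log 2 - 1 / Real.log 3 else 0) ≤
      1 / Real.log 2 - 1 / Real.log 3 := by
    split_ifs <;> linarith
  have h6 : (S.card : ℝ) * (1 / Real.log 3) ≤ (y / 3 + 5 / 3) * (1 / Real.log 3) := by gcongr
  have h7 : (y / 3 + 5 / 3) * (1 / Real.log 3) =
      (y / 3 + 2 / 3) / Real.log 3 + 1 / Real.log 3 := by field_simp; ring
  linarith

theorem log_card_divisors_sub_le {n : ℕ} (hn : n ≠ 0) {s : ℝ} (hs : 0 < s) :
    Real.log n.divisors.card - Real.log n / s ≤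
      primeLogDefect ⌊(2 : ℝ) ^ s⌋₊ (2 ^ s) / s +
      primeLogDefect ⌊(3 / 2 : ℝ) ^ s⌋₊ ((3 / 2) ^ s) / s +
      0.06 * s * (1 / Real.log 2 + ((4 / 3 : ℝ) ^ s / 3 + 2 / 3) / Real.log 3) := by
  have hP : ∀ p ∈ n.primeFactors, p.Prime := fun p hp => Nat.prime_of_mem_primeFactors hp
  have hmax : ∀ a : ℝ, 0 < a → ∑ p ∈ n.primeFactors, max 0 (Real.log a - Real.log p / s) ≤
      primeLogDefect ⌊a ^ s⌋₊ (a ^ s) / s := by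
    intro a ha
    rw [le_div_iff₀ hs, sum_mul]
    refine le_trans (le_of_eq (sum_congr rfl fun p _ => ?_))
      (sum_max_log_sub_le_primeLogDefect _ hP (Real.rpow_pos_of_pos ha s))
    rw [max_mul_of_nonneg _ _ hs.le, Real.log_rpow ha, sub_mul, div_mul_cancel₀ _ hs.ne',
      zero_mul, mul_comm s]
  have hsmall : (∑ p ∈ n.primeFactors,
      if Real.log p / s ≤ Real.log (4 / 3) then 0.06 / (Real.log p / s) else 0) ≤
      0.06 * s * (1 / Real.log 2 + ((4 / 3 : ℝ) ^ s / 3 + 2 / 3) / Real.log 3) := by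
    rw [← sum_filter]
    have h := sum_inv_log_le {p ∈ n.primeFactors | Real.log p / s ≤ Real.log (4 / 3)}
      (fun p hp => hP p (mem_filter.1 hp).1)
        (y := (4 / 3 : ℝ) ^ s) (by positivity) fun p hp => by
          have hp' := mem_filter.1 hp
          have hp0 : (0 : ℝ) < p := by exact_mod_cast (hP p hp'.1).pos
          rw [← Real.log_le_log_iff hp0 (by positivity), Real.log_rpow (by norm_num),
            mul_comm s, ← div_le_iff₀ hs]
          exact hp'.2
    refine le_trans (le_of_eq ?_) (mul_le_mul_of_nonneg_left h (by positivity))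
    rw [mul_sum]
    exact sum_congr rfl fun p _ => by rw [div_div_eq_mul_div, mul_one_div]
  rw [log_card_divisors hn, log_eq_sum_factorization hn, sum_div, ← sum_sub_distrib]
  refine le_trans ?_ (add_le_add (add_le_add (hmax 2 (by norm_num)) (hmax (3 / 2) (by norm_num)))
    hsmall)
  rw [← sum_add_distrib, ← sum_add_distrib]
  refine sum_le_sum fun p hp => ?_
  rw [mul_div_assoc]
  exact log_succ_sub_mul_le _ (div_pos (Real.log_pos (by exact_mod_cast (hP p hp).one_lt)) hs)

theorem two_rpow_ge (m : ℕ) (t : ℝ) : 2 ^ m * (1 + Real.log 2 * t) ≤ (2 : ℝ) ^ (m + t : ℝ) := by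
  rw [Real.rpow_add two_pos, Real.rpow_natCast]
  gcongr
  rw [Real.rpow_def_of_pos two_pos]
  linarith [Real.add_one_le_exp (Real.log 2 * t)]

theorem one_add_rpow_le (m : ℕ) {a t : ℝ} (ha : 0 ≤ a) (ht : 0 ≤ t) (ht1 : t ≤ 1) :
    (1 + a) ^ (m + t : ℝ) ≤ (1 + a) ^ m * (1 + t * a) := by
  rw [Real.rpow_add (by positivity), Real.rpow_natCast]
  gcongr
  exact rpow_one_add_le_one_add_mul_self (by linarith) ht ht1

theorem rpow_bound_of_le_nine {s : ℝ} (hs : 1 ≤ s) (hs9 : s ≤ 9) :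
    s ^ 2 * (1.8326 * s - 1.82 + (3 / 2 : ℝ) ^ s / 3 +
      s ^ 2 * (0.0866 + 0.0547 * ((4 / 3 : ℝ) ^ s / 3 + 2 / 3))) <
      2 ^ s * (2.081 * s + 21 - s ^ 2 / 3) := by
  obtain ⟨m, t, hm1, hm8, ht, ht1, rfl⟩ :
      ∃ (m : ℕ) (t : ℝ), 1 ≤ m ∧ m ≤ 8 ∧ 0 ≤ t ∧ t ≤ 1 ∧ s = m + t := by
    rcases hs9.eq_or_lt with rfl | h
    · exact ⟨8, 1, by norm_num, by norm_num, by norm_num, by norm_num, by norm_num⟩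
    · have h0 : 0 ≤ s := by linarith
      refine ⟨⌊s⌋₊, s - ⌊s⌋₊, Nat.le_floor (by simpa), ?_, ?_, ?_, by ring⟩
      · exact Nat.lt_succ_iff.1 ((Nat.floor_lt h0).2 (by norm_num; exact h))
      · linarith [Nat.floor_le h0]
      · linarith [Nat.lt_floor_add_one s]
  have h2 : 2 ^ m * (1 + 0.693 * t) ≤ (2 : ℝ) ^ (m + t : ℝ) := by
    refine le_trans ?_ (two_rpow_ge m t)
    gcongr
    linarith [Real.log_two_gt_d9]
  have h32 := one_add_rpow_le m (a := 1 / 2) (by norm_num) ht ht1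
  have h43 := one_add_rpow_le m (a := 1 / 3) (by norm_num) ht ht1
  rw [show (1 : ℝ) + 1 / 2 = 3 / 2 by norm_num] at h32
  rw [show (1 : ℝ) + 1 / 3 = 4 / 3 by norm_num] at h43
  have hq : 0 ≤ 2.081 * (m + t) + 21 - (m + t) ^ 2 / 3 := by nlinarith
  calc _ ≤ (m + t) ^ 2 * (1.8326 * (m + t) - 1.82 + ((3 / 2 : ℝ) ^ m * (1 + t * (1 / 2))) / 3 +
      (m + t) ^ 2 * (0.0866 + 0.0547 * (((4 / 3 : ℝ) ^ m * (1 + t * (1 / 3))) / 3 + 2 / 3))) := by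
        gcongr
    _ < 2 ^ m * (1 + 0.693 * t) * (2.081 * (m + t) + 21 - (m + t) ^ 2 / 3) := by
        clear h2 h32 h43 hq hs hs9
        have t2 : 0 ≤ t * (1 - t) := mul_nonneg ht (by linarith)
        have t3 : 0 ≤ t ^ 2 * (1 - t) := mul_nonneg (by positivity) (by linarith)
        have t4 : 0 ≤ t ^ 3 * (1 - t) := mul_nonneg (by positivity) (by linarith)
        have t5 : 0 ≤ t ^ 4 * (1 - t) := mul_nonneg (by positivity) (by linarith)
        interval_cases m <;> push_cast <;> nlinarith
    _ ≤ _ := by gcongr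

theorem pow_mul_rpow_le (k : ℕ) {a s₀ s : ℝ} (ha : 0 < a) (hs₀ : 0 < s₀)
    (hk : k ≤ s₀ * -Real.log a) (hs : s₀ ≤ s) :
    s ^ k * a ^ s ≤ s₀ ^ k * a ^ s₀ := by
  have hs0 : 0 < s := hs₀.trans_le hs
  have h1 := Real.log_le_sub_one_of_pos (div_pos hs0 hs₀)
  rw [Real.log_div hs0.ne' hs₀.ne'] at h1
  have h2 : k * (s / s₀ - 1) ≤ s₀ * -Real.log a * (s / s₀ - 1) := by
    refine mul_le_mul_of_nonneg_right hk (sub_nonneg.2 ((one_le_div hs₀).2 hs))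
  have h3 : s₀ * -Real.log a * (s / s₀ - 1) = -Real.log a * (s - s₀) := by field_simp
  have h4 : k * (Real.log s - Real.log s₀) ≤ k * (s / s₀ - 1) := by gcongr
  rw [← Real.log_le_log_iff (by positivity) (by positivity), Real.log_mul (by positivity)
    (by positivity), Real.log_mul (by positivity) (by positivity), Real.log_pow, Real.log_pow,
    Real.log_rpow ha, Real.log_rpow ha]
  linarith

theorem rpow_bound_of_nine_le {s : ℝ} (hs : 9 ≤ s) :
    s ^ 3 * ((3 / 2 : ℝ) ^ s / (3 * s) + 0.677 + s * (0.0866 + 0.0547 *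
      ((4 / 3 : ℝ) ^ s / 3 + 2 / 3))) ≤ 9.4 * 2 ^ s := by
  have hs0 : 0 < s := by linarith
  have l1 := Real.log_two_gt_d9
  have l2 := Real.log_two_lt_d9
  have l3 := Real.log_three_gt_d9
  have l4 := Real.log_three_lt_d9
  have e34 : Real.log (3 / 4) = Real.log 3 - 2 * Real.log 2 := by
    rw [Real.log_div (by norm_num) (by norm_num), show (4 : ℝ) = 2 ^ 2 by norm_num, Real.log_pow]
    norm_num
  have e12 : Real.log (1 / 2) = - Real.log 2 := by rw [one_div, Real.log_inv]
  have e23 : Real.log (2 / 3) = Real.log 2 - Real.log 3 :=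
    Real.log_div (by norm_num) (by norm_num)
  have h1 := pow_mul_rpow_le 2 (a := 3 / 4) (s₀ := 9) (by norm_num) (by norm_num)
    (by rw [e34]; norm_num; linarith) hs
  have h2 := pow_mul_rpow_le 4 (a := 1 / 2) (s₀ := 9) (by norm_num) (by norm_num)
    (by rw [e12]; norm_num; linarith) hs
  have h3 := pow_mul_rpow_le 3 (a := 1 / 2) (s₀ := 9) (by norm_num) (by norm_num)
    (by rw [e12]; norm_num; linarith) hs
  have h4 : s ^ 4 * (2 / 3) ^ s ≤ 10 ^ 4 * (2 / 3 : ℝ) ^ 9 := by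
    rcases le_or_gt s 10 with h | h
    · have : (2 / 3 : ℝ) ^ s ≤ (2 / 3) ^ (9 : ℝ) :=
        Real.rpow_le_rpow_of_exponent_ge (by norm_num) (by norm_num) hs
      norm_num at this
      norm_num
      calc _ ≤ (10 : ℝ) ^ 4 * (512 / 19683) := by gcongr
        _ = _ := by norm_num
    · have h4 := pow_mul_rpow_le 4 (a := 2 / 3) (s₀ := 10) (by norm_num) (by norm_num)
        (by rw [e23]; norm_num; linarith) h.le
      norm_num at h4 ⊢
      linarith
  have p2 : (0 : ℝ) < 2 ^ s := by positivity
  have d1 : (3 / 2 : ℝ) ^ s = (3 / 4) ^ s * 2 ^ s := by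
    rw [← Real.mul_rpow (by norm_num) (by norm_num)]; norm_num
  have d2 : (1 : ℝ) = (1 / 2) ^ s * 2 ^ s := by
    rw [← Real.mul_rpow (by norm_num) (by norm_num)]; norm_num
  have d3 : (4 / 3 : ℝ) ^ s = (2 / 3) ^ s * 2 ^ s := by
    rw [← Real.mul_rpow (by norm_num) (by norm_num)]; norm_num
  have e : s ^ 3 * ((3 / 2 : ℝ) ^ s / (3 * s) + 0.677 + s * (0.0866 + 0.0547 *
      ((4 / 3 : ℝ) ^ s / 3 + 2 / 3))) = (s ^ 2 * (3 / 4 : ℝ) ^ s / 3 +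
        0.677 * (s ^ 3 * (1 / 2) ^ s) + (0.0866 + 0.0547 * 2 / 3) * (s ^ 4 * (1 / 2) ^ s) +
        0.0547 / 3 * (s ^ 4 * (2 / 3) ^ s)) * 2 ^ s := by
    rw [d1, d3]
    linear_combination (0.677 * s ^ 3 + (0.0866 + 0.0547 * 2 / 3) * s ^ 4) * d2 +
      (3 / 4 : ℝ) ^ s * 2 ^ s * s ^ 2 / 3 * (mul_inv_cancel₀ hs0.ne')
  rw [e]
  gcongr
  norm_num at h1 h2 h3 h4 ⊢
  linarith

theorem log_divisor_bound {n : ℕ} (hn : n ≠ 0) {s : ℝ} (hs : 1 < s) :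
    Real.log n.divisors.card - Real.log n / s <
      2 ^ s / (s * Real.log 2) ^ 2 + 7 * 2 ^ s / (s * Real.log 2) ^ 3 := by
  have hs0 : 0 < s := by linarith
  have l1 := Real.log_two_gt_d9
  have l2 := Real.log_two_lt_d9
  have l3 := Real.log_three_gt_d9
  have l4 := Real.log_three_lt_d9
  have e32 : Real.log (3 / 2) = Real.log 3 - Real.log 2 :=
    Real.log_div (by norm_num) (by norm_num)
  have p2 : (0 : ℝ) < 2 ^ s := by positivity
  have i2 : 1 / Real.log 2 ≤ 1 / 0.693 := by gcongr; linarith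
  have hM : primeLogDefect ⌊(3 / 2 : ℝ) ^ s⌋₊ ((3 / 2) ^ s) / s +
      0.06 * s * (1 / Real.log 2 + ((4 / 3 : ℝ) ^ s / 3 + 2 / 3) / Real.log 3) ≤
      (3 / 2 : ℝ) ^ s / (3 * s) + 0.677 + s * (0.0866 + 0.0547 *
      ((4 / 3 : ℝ) ^ s / 3 + 2 / 3)) := by
    have h1 := primeLogDefect_floor_le' (Real.one_le_rpow (show (1 : ℝ) ≤ 3 / 2 by norm_num) hs0.le)
    rw [Real.log_rpow (by norm_num)] at h1
    have h2 : primeLogDefect ⌊(3 / 2 : ℝ) ^ s⌋₊ ((3 / 2) ^ s) / s ≤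
        (3 / 2 : ℝ) ^ s / (3 * s) + 0.677 := by
      rw [div_le_iff₀ hs0]
      have : ((3 / 2 : ℝ) ^ s / (3 * s) + 0.677) * s = (3 / 2 : ℝ) ^ s / 3 + 0.677 * s := by
        field_simp
      rw [this]
      have : s * Real.log (3 / 2) ≤ s * 0.4056 := by gcongr; linarith
      linarith
    have h3 : ((4 / 3 : ℝ) ^ s / 3 + 2 / 3) / Real.log 3 ≤
        ((4 / 3 : ℝ) ^ s / 3 + 2 / 3) / 1.098 := by gcongr; linarith
    have h4 : 0.06 * s * (1 / Real.log 2 + ((4 / 3 : ℝ) ^ s / 3 + 2 / 3) / Real.log 3) ≤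
        0.06 * s * (1 / 0.693 + ((4 / 3 : ℝ) ^ s / 3 + 2 / 3) / 1.098) := by gcongr
    have h5 : 0.06 * s * (1 / 0.693 + ((4 / 3 : ℝ) ^ s / 3 + 2 / 3) / 1.098) ≤
        s * (0.0866 + 0.0547 * ((4 / 3 : ℝ) ^ s / 3 + 2 / 3)) := by
      have : 0 ≤ s * ((4 / 3 : ℝ) ^ s / 3 + 2 / 3) := by positivity
      norm_num at this ⊢
      linarith
    linarith
  have hle := log_card_divisors_sub_le hn hs0
  suffices h : primeLogDefect ⌊(2 : ℝ) ^ s⌋₊ (2 ^ s) / s + ((3 / 2 : ℝ) ^ s / (3 * s) + 0.677 +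
      s * (0.0866 + 0.0547 * ((4 / 3 : ℝ) ^ s / 3 + 2 / 3))) <
      2 ^ s / (s * Real.log 2) ^ 2 + 7 * 2 ^ s / (s * Real.log 2) ^ 3 by linarith
  have c2 : 2.0813 ≤ 1 / Real.log 2 ^ 2 := by
    rw [le_div_iff₀ (by positivity)]; nlinarith
  have c3 : 21.01 ≤ 7 / Real.log 2 ^ 3 := by
    have : Real.log 2 ^ 3 ≤ 0.69315 ^ 3 := by gcongr; linarith
    rw [le_div_iff₀ (by positivity)]; linarith
  have hlog : Real.log (2 ^ s) = s * Real.log 2 := Real.log_rpow two_pos s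
  rcases le_or_gt s 9 with h9 | h9
  · have h1 := primeLogDefect_floor_le (y := 2 ^ s)
      (by simpa using Real.rpow_le_rpow_of_exponent_le one_le_two hs.le)
    rw [hlog] at h1
    have h2 := rpow_bound_of_le_nine hs.le h9
    have h3 : s * Real.log 2 ≤ s * 0.69315 := by gcongr; linarith
    have h4 : primeLogDefect ⌊(2 : ℝ) ^ s⌋₊ (2 ^ s) / s ≤
        (2 ^ s / 3 + 1.15526 * s - 1.82) / s := by
      gcongr; linarith
    have h5 : 2 ^ s / (s * Real.log 2) ^ 2 + 7 * 2 ^ s / (s * Real.log 2) ^ 3 =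
        2 ^ s * (1 / Real.log 2 ^ 2 * s + 7 / Real.log 2 ^ 3) / s ^ 3 := by
      field_simp
    have h6 : 2 ^ s * (2.081 * s + 21) / s ^ 3 ≤
        2 ^ s * (1 / Real.log 2 ^ 2 * s + 7 / Real.log 2 ^ 3) / s ^ 3 := by
      gcongr <;> linarith
    rw [h5]
    refine lt_of_lt_of_le (lt_of_le_of_lt (add_le_add_left h4 _) ?_) h6
    rw [lt_div_iff₀ (by positivity)]
    have h7 : ((2 ^ s / 3 + 1.15526 * s - 1.82) / s + ((3 / 2 : ℝ) ^ s / (3 * s) + 0.677 +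
        s * (0.0866 + 0.0547 * ((4 / 3 : ℝ) ^ s / 3 + 2 / 3)))) * s ^ 3 =
        s ^ 2 * (2 ^ s / 3 + 1.83226 * s - 1.82 + (3 / 2 : ℝ) ^ s / 3 +
        s ^ 2 * (0.0866 + 0.0547 * ((4 / 3 : ℝ) ^ s / 3 + 2 / 3))) := by
      field_simp; ring
    rw [h7]
    have h8 : 0 < s ^ 3 := by positivity
    linarith
  · have h512 : (512 : ℝ) ≤ 2 ^ s := by
      calc (512 : ℝ) = 2 ^ (9 : ℝ) := by norm_num
        _ ≤ 2 ^ s := Real.rpow_le_rpow_of_exponent_le one_le_two h9.le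
    have h1 := primeLogDefect_floor_le_chebyshev h512
    have h2 := rpow_bound_of_nine_le h9.le
    have log4 : Real.log 4 = 2 * Real.log 2 := by
      rw [show (4 : ℝ) = 2 ^ 2 by norm_num, Real.log_pow]; norm_num
    rw [hlog, log4] at h1
    set E := (3 / 2 : ℝ) ^ s / (3 * s) + 0.677 +
      s * (0.0866 + 0.0547 * ((4 / 3 : ℝ) ^ s / 3 + 2 / 3))
    have h3 : primeLogDefect ⌊(2 : ℝ) ^ s⌋₊ (2 ^ s) / s ≤
        2 * 2 ^ s / s ^ 2 + 8 / Real.log 2 * 2 ^ s / s ^ 3 := by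
      rw [div_le_iff₀ hs0]
      refine h1.trans (le_of_eq ?_)
      field_simp; ring
    have h4 : E ≤ 9.4 * 2 ^ s / s ^ 3 := by
      rw [le_div_iff₀ (by positivity)]; linarith
    have h5 : 2 ^ s / (s * Real.log 2) ^ 2 + 7 * 2 ^ s / (s * Real.log 2) ^ 3 =
        1 / Real.log 2 ^ 2 * 2 ^ s / s ^ 2 + 7 / Real.log 2 ^ 3 * 2 ^ s / s ^ 3 := by
      field_simp
    have h6 : 2 * 2 ^ s / s ^ 2 < 1 / Real.log 2 ^ 2 * 2 ^ s / s ^ 2 := by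
      gcongr; linarith
    have h7 : (8 / Real.log 2 + 9.4) * 2 ^ s / s ^ 3 ≤ 7 / Real.log 2 ^ 3 * 2 ^ s / s ^ 3 := by
      gcongr
      have : 8 / Real.log 2 ≤ 8 / 0.693 := by gcongr; linarith
      norm_num at this c3 ⊢
      linarith
    rw [h5]
    have h8 : (8 / Real.log 2 + 9.4) * 2 ^ s / s ^ 3 =
      8 / Real.log 2 * 2 ^ s / s ^ 3 + 9.4 * 2 ^ s / s ^ 3 := by ring
    linarith

theorem tau_explicit_bound (n : ℕ) (hn : 1 ≤ n) (δ : ℝ) (hδ0 : 0 < δ) (hδ1 : δ < 1) :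
    (n.divisors.card : ℝ) <
      Real.exp (δ ^ 2 * 2 ^ (1 / δ) / (Real.log 2) ^ 2
        + 7 * δ ^ 3 * 2 ^ (1 / δ) / (Real.log 2) ^ 3) * (n : ℝ) ^ δ := by
  have hn0 : n ≠ 0 := by omega
  have hnpos : (0 : ℝ) < n := by positivity
  have hτ : (0 : ℝ) < n.divisors.card := by
    exact_mod_cast card_pos.2 ⟨1, Nat.one_mem_divisors.2 hn0⟩
  have h := log_divisor_bound hn0 ((one_lt_div hδ0).2 hδ1)
  rw [← Real.log_lt_log_iff hτ (by positivity), Real.log_mul (by positivity) (by positivity),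
    Real.log_exp, Real.log_rpow hnpos]
  have e1 : Real.log n / (1 / δ) = δ * Real.log n := by field_simp
  have e2 : (2 : ℝ) ^ (1 / δ) / (1 / δ * Real.log 2) ^ 2 =
      δ ^ 2 * 2 ^ (1 / δ) / Real.log 2 ^ 2 := by
    rw [mul_pow, div_pow]; field_simp
  have e3 : 7 * (2 : ℝ) ^ (1 / δ) / (1 / δ * Real.log 2) ^ 3 =
      7 * δ ^ 3 * 2 ^ (1 / δ) / Real.log 2 ^ 3 := by
    rw [mul_pow, div_pow]; field_simp
  rw [e1, e2, e3] at h
  linarith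
end
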